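/- arXiv:1303.3166 — 3 statements merged into one kernel-verified Lean document; each statement's English description precedes it below -/
import Mathlib

section
/- Fix a constant c > 0. There is a constant C > 0 such that for every sufficiently large k and every c-Ramsey graph G on n = 2^k vertices, the CNF formula Ψ_G has a treelike resolution refutation of length at most n^{C·log₂ n}. -/
open Classical
noncomputable section

/-- A clause: a finite set of literals, where a literal is a pair (variable, polarity). -/
abbrev Clause (V : Type) := Finset (V × Bool)

/-- A literal `(x, b)` is satisfied by assignment `a` iff `a x = b`. -/
def litSat {V : Type} (a : V → Bool) (l : V × Bool) : Prop := a l.1 = l.2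

/-- A clause is satisfied if some literal in it is satisfied. -/
def clauseSat {V : Type} (a : V → Bool) (C : Clause V) : Prop := ∃ l ∈ C, litSat a l

/-- A CNF formula: a set of clauses. -/
abbrev CNF (V : Type) := Set (Clause V)

/-- A CNF is satisfiable if some assignment satisfies all its clauses. -/
def Satisfiable {V : Type} (φ : CNF V) : Prop := ∃ a : V → Bool, ∀ C ∈ φ, clauseSat a C

/-- A resolution refutation of a CNF `φ`: a sequence of clauses, each either a clause of `φ`
or obtained from two earlier clauses `A ∨ x`, `B ∨ ¬x` by the resolution rule (yielding
`A ∨ B`), ending with the empty clause. -/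
structure Refutation {V : Type} [DecidableEq V] (φ : CNF V) where
  clauses : List (Clause V)
  nonempty : clauses ≠ []
  valid : ∀ i : Fin clauses.length, clauses.get i ∈ φ ∨
    ∃ j k : Fin clauses.length, j < i ∧ k < i ∧
      ∃ (x : V) (A B : Clause V),
        clauses.get j = insert (x, true) A ∧
        clauses.get k = insert (x, false) B ∧
        clauses.get i = A ∪ B
  last_empty : clauses.getLast nonempty = ∅

/-- The length of a refutation: the number of clauses in the sequence. -/
def Refutation.length {V : Type} [DecidableEq V] {φ : CNF V} (R : Refutation φ) : ℕ :=
  R.clauses.length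

/-- The width of a refutation: the maximum width (number of literals) of a clause in it. -/
def Refutation.width {V : Type} [DecidableEq V] {φ : CNF V} (R : Refutation φ) : ℕ :=
  (R.clauses.map Finset.card).foldr max 0

/-- `L(φ)`: minimum length of a resolution refutation of `φ` (`⊤` if none exists,
in particular if `φ` is satisfiable). -/
def resLength {V : Type} [DecidableEq V] (φ : CNF V) : ℕ∞ :=
  sInf {l : ℕ∞ | ∃ R : Refutation φ, (R.length : ℕ∞) = l}

/-- `W(φ)`: minimum over refutations of the maximum clause width. -/
def resWidth {V : Type} [DecidableEq V] (φ : CNF V) : ℕ :=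
  sInf {w : ℕ | ∃ R : Refutation φ, R.width = w}

/-- Treelike resolution derivations of a clause from the clauses of `φ`. -/
inductive ResTree {V : Type} [DecidableEq V] (φ : CNF V) : Clause V → Type
  | ax (C : Clause V) (h : C ∈ φ) : ResTree φ C
  | res (x : V) (A B : Clause V) :
      ResTree φ (insert (x, true) A) → ResTree φ (insert (x, false) B) → ResTree φ (A ∪ B)

/-- The length (number of clauses, i.e. nodes) of a treelike derivation. -/
def ResTree.size {V : Type} [DecidableEq V] {φ : CNF V} {C : Clause V} : ResTree φ C → ℕ
  | .ax _ _ => 1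
  | .res _ _ _ t₁ t₂ => t₁.size + t₂.size + 1

/-! ### The Prover–Adversary game -/

/-- A Prover move: query a variable, or erase (forget) a stored value. -/
inductive PMove (V : Type)
  | query (x : V)
  | forget (x : V)

/-- A history of the game: list of moves (most recent first) together with the
Adversary's answer for query moves. -/
abbrev History (V : Type) := List (PMove V × Option Bool)

/-- A Prover strategy: choose the next move given the history so far. -/
def ProverStrat (V : Type) := History V → PMove V

/-- An Adversary strategy: answer a queried variable, given the history so far. -/
def AdvStrat (V : Type) := History V → V → Bool

/-- The stored partial assignment (memory content) determined by a history. -/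
def memOf {V : Type} [DecidableEq V] : History V → V → Option Bool
  | [] => fun _ => none
  | (PMove.query x, ans) :: h => Function.update (memOf h) x ans
  | (PMove.forget x, _) :: h => Function.update (memOf h) x none

/-- The history after `t` rounds of play between strategies `P` and `A`. -/
def play {V : Type} (P : ProverStrat V) (A : AdvStrat V) : ℕ → History V
  | 0 => []
  | t + 1 =>
    let h := play P A t
    match P h with
    | PMove.query x => (PMove.query x, some (A h x)) :: h
    | PMove.forget x => (PMove.forget x, none) :: h

/-- Number of memory locations in use: number of variables with a stored value. -/
def memSize {V : Type} [Fintype V] [DecidableEq V] (h : History V) : ℕ :=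
  (Finset.univ.filter fun x => (memOf h x).isSome).card

/-- The stored partial assignment falsifies clause `C`: every literal of `C` is
assigned and falsified. -/
def falsifies {V : Type} [DecidableEq V] (h : History V) (C : Clause V) : Prop :=
  ∀ l ∈ C, memOf h l.1 = some (!l.2)

/-- The Prover has a strategy winning the game on `φ` while never storing more than `M`
values: against every Adversary, the memory stays within `M` and at some point the
stored partial assignment falsifies a clause of `φ`. -/
def ProverWinsWith {V : Type} [Fintype V] [DecidableEq V] (φ : CNF V) (M : ℝ) : Prop :=
  ∃ P : ProverStrat V, ∀ A : AdvStrat V,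
    (∀ t, (memSize (play P A t) : ℝ) ≤ M) ∧ ∃ t, ∃ C ∈ φ, falsifies (play P A t) C

/-- The Adversary has a strategy winning against every Prover who uses at most `M`
memory locations: whenever the play keeps the memory within `M`, no clause of `φ` is
ever falsified. -/
def AdversaryWinsAgainst {V : Type} [Fintype V] [DecidableEq V] (φ : CNF V) (M : ℝ) : Prop :=
  ∃ A : AdvStrat V, ∀ P : ProverStrat V,
    (∀ t, (memSize (play P A t) : ℝ) ≤ M) → ∀ t, ∀ C ∈ φ, ¬ falsifies (play P A t) C

/-! ### Ramsey graphs and the formulas `Ψ_G`, `Clique(G)` -/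

/-- A graph on `n` vertices is `c`-Ramsey if no set of `c·log₂ n` vertices forms a clique
or an independent set. -/
def IsCRamsey (c : ℝ) {n : ℕ} (G : SimpleGraph (Fin n)) : Prop :=
  ¬ ∃ T : Finset (Fin n), T.card = ⌈c * Real.logb 2 n⌉₊ ∧
      (G.IsClique (T : Set (Fin n)) ∨ Gᶜ.IsClique (T : Set (Fin n)))

/-- The number `ck` of indices. -/
def numIdx (c : ℝ) (k : ℕ) : ℕ := ⌈c * (k : ℕ)⌉₊

/-- Variables of the formula `Clique(G)`: bit `b` of the vertex assigned to index `i`. -/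
abbrev CliqueVar (c : ℝ) (k : ℕ) := Fin (numIdx c k) × Fin k

/-- Variables of `Ψ_G`: the bit variables `x^i_b` together with the extra variable `y`. -/
abbrev PsiVar (c : ℝ) (k : ℕ) := CliqueVar c k ⊕ Unit

/-- Bit `b` of the binary representation of vertex `v`. -/
def vbit {k : ℕ} (v : Fin (2 ^ k)) (b : Fin k) : Bool := Nat.testBit v.val b.val

/-- The clause `⋁_b (x^i_b ≠ v_b)`, saying that index `i` is not mapped to vertex `v`. -/
def neqClause (c : ℝ) (k : ℕ) (i : Fin (numIdx c k)) (v : Fin (2 ^ k)) :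
    Clause (CliqueVar c k) :=
  Finset.univ.image fun b : Fin k => (((i, b) : CliqueVar c k), ! vbit v b)

/-- The CNF `Clique(G)`: injectivity clauses, plus for each non-edge `{u,v}` and distinct
indices `i,j` the clause `⋁_b (x^i_b ≠ u_b) ∨ ⋁_b (x^j_b ≠ v_b)`.  It is satisfiable iff
`G` has a clique of size `ck`. -/
def CliqueCNF (c : ℝ) {k : ℕ} (G : SimpleGraph (Fin (2 ^ k))) : CNF (CliqueVar c k) :=
  {C | (∃ i j : Fin (numIdx c k), i ≠ j ∧ ∃ v : Fin (2 ^ k),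
          C = neqClause c k i v ∪ neqClause c k j v) ∨
       (∃ i j : Fin (numIdx c k), i ≠ j ∧ ∃ u v : Fin (2 ^ k), u ≠ v ∧ ¬ G.Adj u v ∧
          C = neqClause c k i u ∪ neqClause c k j v)}

/-- Lift a clause on the bit variables to the variable set of `Ψ_G`. -/
def liftClause {c : ℝ} {k : ℕ} (C : Clause (CliqueVar c k)) : Clause (PsiVar c k) :=
  C.image fun l => (Sum.inl l.1, l.2)

/-- The CNF `Ψ_G`: (1) injectivity clauses; (2) for each edge `{u,v}` and distinct `i,j`
the clause `y ∨ ⋁_b (x^i_b ≠ u_b) ∨ ⋁_b (x^j_b ≠ v_b)`; (3) for each non-edge `{u,v}` and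
distinct `i,j` the clause `¬y ∨ ⋁_b (x^i_b ≠ u_b) ∨ ⋁_b (x^j_b ≠ v_b)`. -/
def PsiCNF (c : ℝ) {k : ℕ} (G : SimpleGraph (Fin (2 ^ k))) : CNF (PsiVar c k) :=
  {C | (∃ i j : Fin (numIdx c k), i ≠ j ∧ ∃ v : Fin (2 ^ k),
          C = liftClause (neqClause c k i v ∪ neqClause c k j v)) ∨
       (∃ i j : Fin (numIdx c k), i ≠ j ∧ ∃ u v : Fin (2 ^ k), G.Adj u v ∧
          C = insert (Sum.inr (), true)
                (liftClause (neqClause c k i u ∪ neqClause c k j v))) ∨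
       (∃ i j : Fin (numIdx c k), i ≠ j ∧ ∃ u v : Fin (2 ^ k), u ≠ v ∧ ¬ G.Adj u v ∧
          C = insert (Sum.inr (), false)
                (liftClause (neqClause c k i u ∪ neqClause c k j v)))}

/-! ### Property P, density, probability -/

/-- Property P: for every `U ⊆ V(G)` with `|U| ≤ k/3` and every pattern `p` with
`|p| ≤ k/3`, some common neighbour of `U` is consistent with `p`.  A pattern is a partial
assignment `p : Fin k → Option Bool` of the `k` bits; its size is the number of assigned
bits. -/
def PropertyP {k : ℕ} (G : SimpleGraph (Fin (2 ^ k))) : Prop :=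
  ∀ U : Finset (Fin (2 ^ k)), 3 * U.card ≤ k →
    ∀ p : Fin k → Option Bool, 3 * (Finset.univ.filter fun b => (p b).isSome).card ≤ k →
      ∃ v : Fin (2 ^ k), (∀ u ∈ U, G.Adj u v) ∧
        ∀ (b : Fin k) (bit : Bool), p b = some bit → vbit v b = bit

/-- The mutual density `d(A,B) = e(A,B)/(|A|·|B|)`, where `e(A,B)` is the number of pairs
`(a,b) ∈ A × B` with `{a,b}` an edge. -/
def density {α : Type} (G : SimpleGraph α) (A B : Finset α) : ℝ :=
  (((A ×ˢ B).filter fun ab => G.Adj ab.1 ab.2).card : ℝ) / ((A.card : ℝ) * (B.card : ℝ))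

/-- The probability of the event `P` under the uniform distribution on a finite type;
the uniform distribution on `SimpleGraph (Fin n)` is exactly `G(n, 1/2)`. -/
def probOf {α : Type} [Fintype α] (P : α → Prop) : ℝ :=
  ((Finset.univ.filter P).card : ℝ) / (Fintype.card α : ℝ)

/-! ### The unary formula `Ψ'_G` -/

/-- Variables of the unary formula `Ψ'_G`: variables `p^i_v` for `i ∈ [c·log₂ n]`,
`v ∈ V(G)`, plus the extra variable `y`. -/
abbrev UnaryVar (c : ℝ) (n : ℕ) := (Fin ⌈c * Real.logb 2 n⌉₊ × Fin n) ⊕ Unit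

/-- The unary CNF `Ψ'_G`: each index is mapped to exactly one vertex, the map is
injective, and (depending on `y`) the image is a clique or an independent set. -/
def PsiUnary (c : ℝ) {n : ℕ} (G : SimpleGraph (Fin n)) : CNF (UnaryVar c n) :=
  {C | (∃ i : Fin ⌈c * Real.logb 2 n⌉₊,
          C = Finset.univ.image fun v : Fin n => ((Sum.inl (i, v) : UnaryVar c n), true)) ∨
       (∃ i : Fin ⌈c * Real.logb 2 n⌉₊, ∃ u v : Fin n, u ≠ v ∧
          C = {((Sum.inl (i, u) : UnaryVar c n), false), (Sum.inl (i, v), false)}) ∨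
       (∃ i j : Fin ⌈c * Real.logb 2 n⌉₊, i ≠ j ∧ ∃ v : Fin n,
          C = {((Sum.inl (i, v) : UnaryVar c n), false), (Sum.inl (j, v), false)}) ∨
       (∃ i j : Fin ⌈c * Real.logb 2 n⌉₊, i ≠ j ∧ ∃ u v : Fin n, G.Adj u v ∧
          C = {((Sum.inr () : UnaryVar c n), true), (Sum.inl (i, u), false),
               (Sum.inl (j, v), false)}) ∨
       (∃ i j : Fin ⌈c * Real.logb 2 n⌉₊, i ≠ j ∧ ∃ u v : Fin n, u ≠ v ∧ ¬ G.Adj u v ∧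
          C = {((Sum.inr () : UnaryVar c n), false), (Sum.inl (i, u), false),
               (Sum.inl (j, v), false)})}

end

/-- Brute-force treelike refutation: query all the variables of `S`. -/
theorem brute_tree {V : Type} [DecidableEq V] (φ : CNF V)
    (hun : ∀ a : V → Bool, ∃ D ∈ φ, ∀ l ∈ D, a l.1 = !l.2) (S : Finset V) :
    ∀ a : V → Bool, ∃ D : Clause V, (∀ l ∈ D, a l.1 = !l.2 ∧ l.1 ∉ S) ∧
      ∃ t : ResTree φ D, t.size + 1 ≤ 2 ^ (S.card + 1) := by
  induction S using Finset.induction_on with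
  | empty =>
    intro a
    obtain ⟨D, hD, h⟩ := hun a
    exact ⟨D, fun l hl => ⟨h l hl, Finset.notMem_empty _⟩, ResTree.ax D hD, by simp [ResTree.size]⟩
  | insert x S hx ih =>
    intro a
    have key : ∀ v : Bool, ∃ D : Clause V, (∀ l ∈ D, l ≠ (x, !v) → a l.1 = !l.2 ∧ l.1 ∉ insert x S) ∧
        ∃ t : ResTree φ D, t.size + 1 ≤ 2 ^ (S.card + 1) := by
      intro v
      obtain ⟨D, hD, t, ht⟩ := ih (Function.update a x v)
      refine ⟨D, ?_, t, ht⟩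
      rintro ⟨z, w⟩ hl hne
      have h := hD _ hl
      by_cases hz : z = x
      · subst hz
        exfalso
        apply hne
        have h1 := h.1
        simp at h1
        simp [h1]
      · simp only [Function.update_of_ne hz] at h
        exact ⟨h.1, by simp [hz, h.2]⟩
    rw [Finset.card_insert_of_notMem hx]
    obtain ⟨D0, h0, t0, s0⟩ := key false
    obtain ⟨D1, h1, t1, s1⟩ := key true
    have hp : 2 ^ (S.card + 1 + 1) = 2 ^ (S.card + 1) + 2 ^ (S.card + 1) := by ring
    by_cases m0 : (x, true) ∈ D0
    · by_cases m1 : (x, false) ∈ D1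
      · have e0 : insert (x, true) (D0.erase (x, true)) = D0 := Finset.insert_erase m0
        have e1 : insert (x, false) (D1.erase (x, false)) = D1 := Finset.insert_erase m1
        have k0 : ∃ t : ResTree φ (insert (x, true) (D0.erase (x, true))),
            t.size + 1 ≤ 2 ^ (S.card + 1) := by rw [e0]; exact ⟨t0, s0⟩
        have k1 : ∃ t : ResTree φ (insert (x, false) (D1.erase (x, false))),
            t.size + 1 ≤ 2 ^ (S.card + 1) := by rw [e1]; exact ⟨t1, s1⟩
        obtain ⟨u0, q0⟩ := k0
        obtain ⟨u1, q1⟩ := k1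
        refine ⟨_, ?_, ResTree.res x _ _ u0 u1, ?_⟩
        · intro l hl
          rcases Finset.mem_union.1 hl with hl | hl
          · have := Finset.mem_erase.1 hl
            exact h0 l this.2 (by simpa using this.1)
          · have := Finset.mem_erase.1 hl
            exact h1 l this.2 (by simpa using this.1)
        · simp only [ResTree.size]
          omega
      · exact ⟨D1, fun l hl => h1 l hl (fun e => m1 (by rw [e] at hl; simpa using hl)), t1, by omega⟩
    · exact ⟨D0, fun l hl => h0 l hl (fun e => m0 (by rw [e] at hl; simpa using hl)), t0, by omega⟩

theorem psi_unsat (c : ℝ) (k : ℕ) (G : SimpleGraph (Fin (2 ^ k))) (hG : IsCRamsey c G)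
    (a : PsiVar c k → Bool) : ∃ D ∈ PsiCNF c G, ∀ l ∈ D, a l.1 = !l.2 := by
  by_contra hcon
  push Not at hcon
  have hf : ∀ i : Fin (numIdx c k), ∃ v : Fin (2 ^ k), ∀ b : Fin k, vbit v b = a (Sum.inl (i, b)) := by
    intro i
    refine ⟨⟨Nat.ofBits (fun b : Fin k => a (Sum.inl (i, b))), Nat.ofBits_lt_two_pow _⟩, ?_⟩
    intro b
    simp [vbit, Nat.testBit_ofBits_lt]
  choose f hf using hf
  have hl : ∀ i j, ∀ l ∈ (liftClause (neqClause c k i (f i) ∪ neqClause c k j (f j)) :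
      Clause (PsiVar c k)), a l.1 = !l.2 := by
    intro i j l hl
    simp only [liftClause, neqClause, Finset.mem_image, Finset.mem_union, Finset.mem_univ,
      true_and] at hl
    obtain ⟨l', (⟨b, rfl⟩ | ⟨b, rfl⟩), rfl⟩ := hl
    · simp [hf]
    · simp [hf]
  have hinj : Function.Injective f := by
    intro i j hij
    by_contra hne
    obtain ⟨l, hlD, h⟩ := hcon _ (Or.inl ⟨i, j, hne, f i, rfl⟩)
    have h2 := hl i j
    rw [← hij] at h2
    exact h (h2 l hlD)
  apply hG
  refine ⟨Finset.univ.image f, ?_, ?_⟩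
  · rw [Finset.card_image_of_injective _ hinj]
    rw [Finset.card_univ, Fintype.card_fin]
    simp [numIdx, Real.logb_pow]
  · cases hy : a (Sum.inr ()) with
    | true =>
      left
      intro u hu v hv huv
      simp only [Finset.coe_image, Finset.coe_univ, Set.image_univ, Set.mem_range] at hu hv
      obtain ⟨i, rfl⟩ := hu
      obtain ⟨j, rfl⟩ := hv
      by_contra hadj
      have hne : i ≠ j := fun e => huv (by rw [e])
      obtain ⟨l, hlD, h⟩ := hcon _ (Or.inr (Or.inr ⟨i, j, hne, f i, f j, huv, hadj, rfl⟩))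
      rcases Finset.mem_insert.1 hlD with rfl | hlD
      · exact h (by simp [hy])
      · exact h (hl i j l hlD)
    | false =>
      right
      intro u hu v hv huv
      simp only [Finset.coe_image, Finset.coe_univ, Set.image_univ, Set.mem_range] at hu hv
      obtain ⟨i, rfl⟩ := hu
      obtain ⟨j, rfl⟩ := hv
      rw [SimpleGraph.compl_adj]
      refine ⟨huv, fun hadj => ?_⟩
      have hne : i ≠ j := fun e => huv (by rw [e])
      obtain ⟨l, hlD, h⟩ := hcon _ (Or.inr (Or.inl ⟨i, j, hne, f i, f j, hadj, rfl⟩))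
      rcases Finset.mem_insert.1 hlD with rfl | hlD
      · exact h (by simp [hy])
      · exact h (hl i j l hlD)

/-- Fix `c > 0`. There is `C > 0` such that for every sufficiently large
`k` and every `c`-Ramsey graph `G` on `n = 2^k` vertices, `Ψ_G` has a treelike resolution
refutation of length at most `n^(C·log₂ n) = n^(C·k)`. -/
theorem psi_treelike_upper_bound (c : ℝ) (hc : 0 < c) :
    ∃ C : ℝ, 0 < C ∧ ∃ K : ℕ, ∀ k : ℕ, K ≤ k →
      ∀ G : SimpleGraph (Fin (2 ^ k)), IsCRamsey c G →
        ∃ t : ResTree (PsiCNF c G) (∅ : Clause (PsiVar c k)),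
          (t.size : ℝ) ≤ ((2 ^ k : ℕ) : ℝ) ^ (C * k) := by
  refine ⟨c + 3, by linarith, 1, fun k hk G hG => ?_⟩
  obtain ⟨D, hD, t, ht⟩ := brute_tree (PsiCNF c G) (psi_unsat c k G hG) Finset.univ (fun _ => false)
  have hD0 : D = ∅ := Finset.eq_empty_of_forall_notMem
    (fun l hl => (hD l hl).2 (Finset.mem_univ _))
  subst hD0
  refine ⟨t, ?_⟩
  have hcard : (Finset.univ : Finset (PsiVar c k)).card = numIdx c k * k + 1 := by
    simp [Finset.card_univ]
  rw [hcard] at ht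
  have hk' : (1 : ℝ) ≤ k := by exact_mod_cast hk
  have hn : (numIdx c k : ℝ) ≤ c * k + 1 :=
    (Nat.ceil_lt_add_one (by positivity)).le
  have hsz : (t.size : ℝ) ≤ (2 : ℝ) ^ (numIdx c k * k + 1 + 1) := by
    have : t.size ≤ 2 ^ (numIdx c k * k + 1 + 1) := by omega
    exact_mod_cast this
  refine hsz.trans ?_
  rw [← Real.rpow_natCast]
  push_cast
  rw [← Real.rpow_natCast 2 k, ← Real.rpow_mul (by norm_num)]
  apply Real.rpow_le_rpow_of_exponent_le (by norm_num)
  nlinarith [mul_le_mul_of_nonneg_right hn (by linarith : (0 : ℝ) ≤ k)]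
end

section
/- Fix a constant c > 0. There is a constant ε > 0 such that for every sufficiently large k and every graph G on n = 2^k vertices, every resolution refutation of the CNF formula Ψ_G has length at least n^{ε·log₂ n} (this holds vacuously when Ψ_G is satisfiable, since then no refutation exists). -/
open Classical
section BSW

inductive Der {V : Type} [DecidableEq V] (φ : CNF V) (R : Clause V) (w : ℕ) : Clause V → Prop
  | ax (C : Clause V) (h : C ∈ φ) : Der φ R w C
  | weak (C C' : Clause V) (hs : C ⊆ C') (h : Der φ R w C) : Der φ R w C'
  | res (x : V) (C : Clause V) (hw : (C \ R).card + 1 ≤ w)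
      (h1 : Der φ R w (insert (x, true) C)) (h2 : Der φ R w (insert (x, false) C)) : Der φ R w C

def nlit {V : Type} (l : V × Bool) : V × Bool := (l.1, !l.2)

theorem nlit_nlit {V : Type} (l : V × Bool) : nlit (nlit l) = l := by simp [nlit]

theorem nlit_ne {V : Type} (l : V × Bool) : nlit l ≠ l := by
  intro h
  have := congrArg Prod.snd h
  simp [nlit] at this

variable {V : Type} [DecidableEq V] {φ : CNF V}

theorem Der.res_lit {R : Clause V} {w : ℕ} (l : V × Bool) (C : Clause V)
    (hw : (C \ R).card + 1 ≤ w)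
    (h1 : Der φ R w (insert l C)) (h2 : Der φ R w (insert (nlit l) C)) : Der φ R w C := by
  obtain ⟨x, b⟩ := l
  cases b
  · exact Der.res x C hw h2 h1
  · exact Der.res x C hw h1 h2

/-- forgetting that a literal is free costs one unit of width -/
theorem Der.unfree {R : Clause V} {w : ℕ} (l : V × Bool) {C : Clause V}
    (h : Der φ (insert l R) w C) : Der φ R (w + 1) C := by
  induction h with
  | ax C h => exact Der.ax C h
  | weak C C' hs _ ih => exact Der.weak C C' hs ih
  | res x C hw _ _ ih1 ih2 =>
    refine Der.res x C ?_ ih1 ih2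
    have h1 : C \ R ⊆ insert l (C \ insert l R) := by
      intro z hz
      simp only [Finset.mem_sdiff, Finset.mem_insert] at *
      tauto
    have h2 := Finset.card_le_card h1
    have h3 := Finset.card_insert_le l (C \ insert l R)
    omega

theorem Der.cut {R : Clause V} {w : ℕ} (l : V × Bool)
    (haw : ∀ C ∈ φ, C.card ≤ w)
    (h0 : Der φ R w (insert l R)) {C : Clause V}
    (h : Der φ (insert (nlit l) R) w C) : Der φ R w (R ∪ C.erase (nlit l)) := by
  induction h with
  | ax C h =>
    by_cases hl : nlit l ∈ C
    · refine Der.res_lit l _ ?_ (Der.weak _ _ ?_ h0) (Der.weak _ _ ?_ (Der.ax C h))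
      · have h1 : ((R ∪ C.erase (nlit l)) \ R) ⊆ C.erase (nlit l) := by
          intro z hz
          simp only [Finset.mem_sdiff, Finset.mem_union] at hz
          tauto
        have h2 := Finset.card_le_card h1
        have h3 := Finset.card_erase_add_one hl
        have := haw C h
        omega
      · intro z hz
        simp only [Finset.mem_insert, Finset.mem_union] at *
        tauto
      · intro z hz
        simp only [Finset.mem_insert, Finset.mem_union, Finset.mem_erase] at *
        tauto
    · refine Der.weak _ _ ?_ (Der.ax C h)
      rw [Finset.erase_eq_of_notMem hl]
      exact Finset.subset_union_right
  | weak C C' hs _ ih =>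
    exact Der.weak _ _ (Finset.union_subset_union_right (Finset.erase_subset_erase _ hs)) ih
  | res x C hw _ _ ih1 ih2 =>
    by_cases hx : x = l.1
    · obtain ⟨y, b⟩ := l
      simp only at hx
      subst hx
      cases b
      · refine Der.weak _ _ ?_ ih1
        intro z hz
        simp only [nlit, Finset.mem_insert, Finset.mem_union, Finset.mem_erase] at *
        tauto
      · refine Der.weak _ _ ?_ ih2
        intro z hz
        simp only [nlit, Finset.mem_insert, Finset.mem_union, Finset.mem_erase] at *
        tauto
    · refine Der.res x _ ?_ (Der.weak _ _ ?_ ih1) (Der.weak _ _ ?_ ih2)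
      · refine le_trans ?_ hw
        have h1 : ((R ∪ C.erase (nlit l)) \ R) ⊆ C \ insert (nlit l) R := by
          intro z hz
          simp only [Finset.mem_sdiff, Finset.mem_union, Finset.mem_insert, Finset.mem_erase] at *
          tauto
        have h2 := Finset.card_le_card h1
        omega
      · intro z hz
        simp only [Finset.mem_insert, Finset.mem_union, Finset.mem_erase] at *
        tauto
      · intro z hz
        simp only [Finset.mem_insert, Finset.mem_union, Finset.mem_erase] at *
        tauto

theorem Der.combine {R : Clause V} {w : ℕ} (l : V × Bool)
    (haw : ∀ C ∈ φ, C.card ≤ w + 1)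
    (h1 : Der φ (insert l R) w (insert l R))
    (h2 : Der φ (insert (nlit l) R) (w + 1) (insert (nlit l) R)) : Der φ R (w + 1) R := by
  have := Der.cut l haw h1.unfree h2
  refine Der.weak _ _ ?_ this
  intro z hz
  simp only [Finset.mem_insert, Finset.mem_union, Finset.mem_erase] at *
  tauto

/-- unsatisfied wide clauses in `Pi` -/
def fat (Pi : Finset (Clause V)) (f : ℕ) (R : Clause V) : Finset (Clause V) :=
  Pi.filter fun C => (∀ l ∈ C, nlit l ∉ R) ∧ f ≤ (C \ R).card

theorem fat_sat {Pi : Finset (Clause V)} {f : ℕ} {R C : Clause V} (h : C ∈ fat Pi f R) :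
    ∀ l ∈ C, nlit l ∉ R := by
  simp only [fat, Finset.mem_filter] at h
  exact h.2.1

theorem fat_sub (Pi : Finset (Clause V)) (f : ℕ) (R : Clause V) : fat Pi f R ⊆ Pi :=
  Finset.filter_subset _ _

theorem fat_nonempty (P : Refutation φ) (R : Clause V) (w f : ℕ) (hfw : f ≤ w)
    (hcons : ∀ l ∈ R, nlit l ∉ R) (hnd : ¬ Der φ R w R) :
    (fat P.clauses.toFinset f R).Nonempty := by
  by_contra hne
  rw [Finset.not_nonempty_iff_eq_empty] at hne
  have key : ∀ n : ℕ, ∀ i : Fin P.clauses.length, i.val = n →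
      (∀ l ∈ P.clauses.get i, nlit l ∉ R) → Der φ R w (R ∪ P.clauses.get i) := by
    intro n
    induction n using Nat.strong_induction_on with
    | _ n ih =>
      intro i hi hsat
      rcases P.valid i with hax | ⟨j, k, hj, hk, x, A, B, hA, hB, hC⟩
      · exact Der.weak _ _ Finset.subset_union_right (Der.ax _ hax)
      · have hnf : (P.clauses.get i \ R).card < f := by
          by_contra hcon
          have : P.clauses.get i ∈ fat P.clauses.toFinset f R := by
            simp only [fat, Finset.mem_filter, List.mem_toFinset]
            exact ⟨List.get_mem _ _, hsat, by omega⟩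
          rw [hne] at this
          simp at this
        have hwid : ((R ∪ P.clauses.get i) \ R).card + 1 ≤ w := by
          rw [Finset.union_sdiff_left]
          omega
        have hAs : ∀ l ∈ A, nlit l ∉ R := fun l hl => hsat l (by rw [hC]; simp [hl])
        have hBs : ∀ l ∈ B, nlit l ∉ R := fun l hl => hsat l (by rw [hC]; simp [hl])
        have ih1 := ih j.val (by rw [← hi]; exact hj) j rfl
        have ih2 := ih k.val (by rw [← hi]; exact hk) k rfl
        rw [hA] at ih1
        rw [hB] at ih2
        by_cases h1 : ((x, false) : V × Bool) ∈ R
        · have h2 : ((x, true) : V × Bool) ∉ R := by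
            have := hcons _ h1
            simpa [nlit] using this
          refine Der.weak _ _ ?_ (ih2 ?_)
          · rw [hC]
            intro z hz
            simp only [Finset.mem_insert, Finset.mem_union] at *
            rcases hz with hz | hz | hz
            · tauto
            · subst hz; tauto
            · tauto
          · intro l hl
            rcases Finset.mem_insert.1 hl with rfl | hl
            · simpa [nlit] using h2
            · exact hBs l hl
        · by_cases h2 : ((x, true) : V × Bool) ∈ R
          · refine Der.weak _ _ ?_ (ih1 ?_)
            · rw [hC]
              intro z hz
              simp only [Finset.mem_insert, Finset.mem_union] at *
              rcases hz with hz | hz | hz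
              · tauto
              · subst hz; tauto
              · tauto
            · intro l hl
              rcases Finset.mem_insert.1 hl with rfl | hl
              · simpa [nlit] using h1
              · exact hAs l hl
          · refine Der.res x _ hwid (Der.weak _ _ ?_ (ih1 ?_)) (Der.weak _ _ ?_ (ih2 ?_))
            · rw [hC]
              intro z hz
              simp only [Finset.mem_insert, Finset.mem_union] at *
              tauto
            · intro l hl
              rcases Finset.mem_insert.1 hl with rfl | hl
              · simpa [nlit] using h1
              · exact hAs l hl
            · rw [hC]
              intro z hz
              simp only [Finset.mem_insert, Finset.mem_union] at *
              tauto
            · intro l hl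
              rcases Finset.mem_insert.1 hl with rfl | hl
              · simpa [nlit] using h2
              · exact hBs l hl
  have hpos : 0 < P.clauses.length := List.length_pos_of_ne_nil P.nonempty
  have hlast := P.last_empty
  rw [List.getLast_eq_getElem] at hlast
  have := key _ ⟨P.clauses.length - 1, by omega⟩ rfl
  simp only [List.get_eq_getElem, hlast] at this
  simp at this
  exact hnd this

theorem popular [Fintype V] (Pi : Finset (Clause V)) (f : ℕ) (R : Clause V)
    (hne : (fat Pi f R).Nonempty) (hf : 0 < f) :
    ∃ l : V × Bool, l ∉ R ∧ nlit l ∉ R ∧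
      (fat Pi f R).card * f ≤
        2 * Fintype.card V * ((fat Pi f R).filter fun C => l ∈ C).card := by
  set F := fat Pi f R with hF
  set L : Finset (V × Bool) := Finset.univ.filter fun l => l ∉ R ∧ nlit l ∉ R with hL
  have hsub : ∀ C ∈ F, C \ R ⊆ L := by
    intro C hC l hl
    simp only [hF, fat, Finset.mem_filter] at hC
    simp only [Finset.mem_sdiff] at hl
    simp only [hL, Finset.mem_filter, Finset.mem_univ, true_and]
    exact ⟨hl.2, hC.2.1 l hl.1⟩
  have hwide : ∀ C ∈ F, f ≤ (C \ R).card := by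
    intro C hC
    simp only [hF, fat, Finset.mem_filter] at hC
    exact hC.2.2
  by_contra hcon
  push Not at hcon
  have hLne : L.Nonempty := by
    obtain ⟨C, hC⟩ := hne
    have h1 := hwide C hC
    have h2 : (C \ R).Nonempty := Finset.card_pos.1 (by omega)
    exact h2.mono (hsub C hC)
  have hsum : ∑ l ∈ L, (F.filter fun C => l ∈ C).card = ∑ C ∈ F, (L.filter fun l => l ∈ C).card :=
    Finset.sum_card_bipartiteAbove_eq_sum_card_bipartiteBelow (fun l C => l ∈ C)
  have h1 : F.card * f ≤ ∑ C ∈ F, (L.filter fun l => l ∈ C).card := by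
    rw [← smul_eq_mul]
    refine Finset.card_nsmul_le_sum _ _ _ ?_
    intro C hC
    refine (hwide C hC).trans (Finset.card_le_card ?_)
    intro l hl
    exact Finset.mem_filter.2 ⟨hsub C hC hl, (Finset.mem_sdiff.1 hl).1⟩
  have hLc : L.card ≤ 2 * Fintype.card V := by
    refine (Finset.card_le_univ L).trans ?_
    simp [Fintype.card_prod, mul_comm]
  have h2 : ∑ l ∈ L, 2 * Fintype.card V * (F.filter fun C => l ∈ C).card
      < ∑ l ∈ L, F.card * f := by
    refine Finset.sum_lt_sum_of_nonempty hLne ?_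
    intro l hl
    simp only [hL, Finset.mem_filter, Finset.mem_univ, true_and] at hl
    exact hcon l hl.1 hl.2
  rw [← Finset.mul_sum, hsum, Finset.sum_const, smul_eq_mul] at h2
  have h3 := Nat.mul_le_mul_right (F.card * f) hLc
  have h4 := Nat.mul_le_mul_left (2 * Fintype.card V) h1
  omega

theorem fat_anti (Pi : Finset (Clause V)) (f : ℕ) (R : Clause V) (l : V × Bool) :
    fat Pi f (insert l R) ⊆ fat Pi f R := by
  intro C hC
  simp only [fat, Finset.mem_filter] at *
  refine ⟨hC.1, fun z hz hz' => hC.2.1 z hz (Finset.mem_insert_of_mem hz'), hC.2.2.trans ?_⟩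
  exact Finset.card_le_card (Finset.sdiff_subset_sdiff subset_rfl (Finset.subset_insert _ _))

theorem fat_bound [Fintype V] (P : Refutation φ) (f : ℕ) (hf : 0 < f)
    (haw : ∀ C ∈ φ, C.card ≤ f) :
    ∀ (n : ℕ) (R : Clause V) (t : ℕ), (Finset.univ \ R).card = n →
      (∀ l ∈ R, nlit l ∉ R) → ¬ Der φ R (f + t) R →
      (2 * Fintype.card V) ^ t ≤
        (fat P.clauses.toFinset f R).card * (2 * Fintype.card V - f) ^ t := by
  intro n
  induction n using Nat.strong_induction_on with
  | _ n ih =>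
    intro R t hn hcons hnd
    have hne := fat_nonempty P R (f + t) f (by omega) hcons hnd
    cases t with
    | zero =>
      have := Finset.card_pos.2 hne
      simpa using this
    | succ t =>
      obtain ⟨l, hl1, hl2, hpop⟩ := popular P.clauses.toFinset f R hne hf
      have hc : ∀ z : V × Bool, z ∉ R → (Finset.univ \ insert z R).card < n := by
        intro z hz
        rw [← hn]
        refine Finset.card_lt_card ?_
        refine Finset.ssubset_iff_subset_ne.2 ⟨Finset.sdiff_subset_sdiff subset_rfl
          (Finset.subset_insert _ _), ?_⟩
        intro h
        have : z ∈ Finset.univ \ insert z R := by rw [h]; simp [hz]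
        simp at this
      have hcons' : ∀ z : V × Bool, z ∉ R → nlit z ∉ R →
          ∀ q ∈ insert z R, nlit q ∉ insert z R := by
        intro z hz hz' q hq hq'
        rcases Finset.mem_insert.1 hq with rfl | hq
        · rcases Finset.mem_insert.1 hq' with h | h
          · exact nlit_ne _ h
          · exact hz' h
        · rcases Finset.mem_insert.1 hq' with h | h
          · rw [← h, nlit_nlit] at hz'
            exact hz' hq
          · exact hcons q hq h
      by_cases hd : Der φ (insert (nlit l) R) (f + t) (insert (nlit l) R)
      · have hd2 : ¬ Der φ (insert l R) (f + (t + 1)) (insert l R) := by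
          intro h
          refine hnd ?_
          have := Der.combine (R := R) (w := f + t) (nlit l)
            (fun C hC => (haw C hC).trans (by omega)) hd (by rw [nlit_nlit]; exact h)
          exact this
        have h1 := ih _ (hc l hl1) (insert l R) (t + 1) rfl (hcons' l hl1 hl2) hd2
        refine h1.trans (Nat.mul_le_mul_right _ (Finset.card_le_card (fat_anti _ _ _ _)))
      · have h1 := ih _ (hc _ hl2) (insert (nlit l) R) t rfl
          (hcons' _ hl2 (by rw [nlit_nlit]; exact hl1)) hd
        set F := fat P.clauses.toFinset f R with hF
        set F' := fat P.clauses.toFinset f (insert (nlit l) R) with hF'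
        have h2 : F'.card + (F.filter fun C => l ∈ C).card ≤ F.card := by
          rw [← Finset.card_union_of_disjoint]
          · refine Finset.card_le_card ?_
            refine Finset.union_subset (fat_anti _ _ _ _) (Finset.filter_subset _ _)
          · rw [Finset.disjoint_left]
            intro C hC hC2
            have h3 := fat_sat hC l (Finset.mem_filter.1 hC2).2
            exact h3 (Finset.mem_insert_self _ _)
        have h3 : 2 * Fintype.card V * F'.card ≤ F.card * (2 * Fintype.card V - f) := by
          have h4 := Nat.mul_le_mul_left (2 * Fintype.card V) h2
          rw [Nat.mul_sub, mul_add] at *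
          have h5 : F.card * (2 * Fintype.card V) = 2 * Fintype.card V * F.card := by ring
          omega
        calc (2 * Fintype.card V) ^ (t + 1)
            = (2 * Fintype.card V) * (2 * Fintype.card V) ^ t := by ring
          _ ≤ (2 * Fintype.card V) * (F'.card * (2 * Fintype.card V - f) ^ t) :=
              Nat.mul_le_mul_left _ h1
          _ = (2 * Fintype.card V * F'.card) * (2 * Fintype.card V - f) ^ t := by ring
          _ ≤ (F.card * (2 * Fintype.card V - f)) * (2 * Fintype.card V - f) ^ t :=
              Nat.mul_le_mul_right _ h3
          _ = F.card * (2 * Fintype.card V - f) ^ (t + 1) := by ring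

theorem size_width [Fintype V] (P : Refutation φ) (f t : ℕ) (hf : 0 < f)
    (haw : ∀ C ∈ φ, C.card ≤ f) (hnd : ¬ Der φ ∅ (f + t) ∅) :
    (2 * Fintype.card V) ^ t ≤ P.length * (2 * Fintype.card V - f) ^ t := by
  have h := fat_bound P f hf haw _ ∅ t rfl (by simp) hnd
  refine h.trans (Nat.mul_le_mul_right _ ?_)
  refine (Finset.card_le_card (fat_sub _ _ _)).trans ?_
  exact List.toFinset_card_le _

end BSW

section Comb

theorem count_small {α : Type} (X : Finset α) (d e r : ℕ)
    (h : e * d * 2 ^ e + 2 * X.card ≤ r * 2 ^ e) :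
    (X.powerset.filter fun D => D.card ≤ d).card ≤ 2 ^ r := by
  set x : ℝ := (1 / 2 : ℝ) ^ e with hx
  have hx0 : 0 < x := by positivity
  have hx1 : x ≤ 1 := pow_le_one₀ (by norm_num) (by norm_num)
  set F := X.powerset.filter fun D => D.card ≤ d with hF
  have h1 : (F.card : ℝ) * x ^ d ≤ (1 + x) ^ X.card := by
    have h2 : ∑ D ∈ X.powerset, x ^ D.card * (1 : ℝ) ^ (X.card - D.card) = (x + 1) ^ X.card :=
      Finset.sum_pow_mul_eq_add_pow x 1 X
    rw [add_comm 1 x, ← h2, ← nsmul_eq_mul]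
    calc F.card • x ^ d ≤ ∑ D ∈ F, x ^ D.card := by
          refine Finset.card_nsmul_le_sum _ _ _ ?_
          intro D hD
          exact pow_le_pow_of_le_one hx0.le hx1 (Finset.mem_filter.1 hD).2
      _ ≤ ∑ D ∈ X.powerset, x ^ D.card := by
          refine Finset.sum_le_sum_of_subset_of_nonneg (Finset.filter_subset _ _) ?_
          intros; positivity
      _ = _ := by simp
  have h3 : (1 + x) ^ X.card ≤ (2 : ℝ) ^ (2 * x * X.card) := by
    have h4 : 1 + x ≤ Real.exp x := by linarith [Real.add_one_le_exp x]
    have h5 : Real.exp x ≤ (2 : ℝ) ^ (2 * x) := by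
      rw [Real.rpow_def_of_pos (by norm_num)]
      refine Real.exp_le_exp.2 ?_
      have := Real.log_two_gt_d9
      nlinarith
    calc (1 + x) ^ X.card ≤ ((2 : ℝ) ^ (2 * x)) ^ X.card :=
          pow_le_pow_left₀ (by positivity) (h4.trans h5) _
      _ = _ := by rw [← Real.rpow_natCast, ← Real.rpow_mul (by norm_num)]
  have h6 : x ^ d = (2 : ℝ) ^ (-((e : ℝ) * d)) := by
    rw [hx, ← pow_mul, one_div, inv_pow, Real.rpow_neg (by norm_num)]
    congr 1
    rw [← Nat.cast_mul, Real.rpow_natCast]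
  have h7 : 2 * x * X.card ≤ r - e * d := by
    have h8 : ((e * d * 2 ^ e + 2 * X.card : ℕ) : ℝ) ≤ ((r * 2 ^ e : ℕ) : ℝ) := by
      exact_mod_cast h
    push_cast at h8
    have h9 : x * 2 ^ e = 1 := by
      rw [hx, ← mul_pow]; norm_num
    have h10 := mul_le_mul_of_nonneg_left h8 hx0.le
    have h11 : x * (e * d * 2 ^ e + 2 * X.card) = e * d + 2 * x * X.card := by
      linear_combination (e * d : ℝ) * h9
    have h12 : x * (r * 2 ^ e) = r := by
      linear_combination (r : ℝ) * h9
    linarith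
  have h13 : (F.card : ℝ) ≤ (2 : ℝ) ^ (r : ℝ) := by
    have h14 : (F.card : ℝ) * x ^ d ≤ (2 : ℝ) ^ ((r : ℝ) - e * d) :=
      (h1.trans h3).trans (Real.rpow_le_rpow_of_exponent_le (by norm_num) h7)
    rw [sub_eq_add_neg, Real.rpow_add (by norm_num), ← h6] at h14
    exact le_of_mul_le_mul_right h14 (by positivity)
  rw [Real.rpow_natCast] at h13
  exact_mod_cast h13

/-- patterns: a small set of positions together with the subset of ones -/
noncomputable def Pats (k d : ℕ) : Finset (Σ _ : Finset (Fin k), Finset (Fin k)) :=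
  ((Finset.univ : Finset (Fin k)).powerset.filter fun D => D.card ≤ d).sigma fun D => D.powerset

theorem card_Pats (k d e r : ℕ) (h : e * d * 2 ^ e + 2 * k ≤ r * 2 ^ e) :
    (Pats k d).card ≤ 2 ^ (r + d) := by
  have h1 := count_small (Finset.univ : Finset (Fin k)) d e r (by simpa using h)
  rw [Pats, Finset.card_sigma]
  calc _ ≤ ∑ D ∈ ((Finset.univ : Finset (Fin k)).powerset.filter fun D => D.card ≤ d), 2 ^ d := by
        refine Finset.sum_le_sum ?_
        intro D hD
        rw [Finset.card_powerset]
        exact Nat.pow_le_pow_right (by norm_num) (Finset.mem_filter.1 hD).2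
    _ ≤ 2 ^ r * 2 ^ d := by
        rw [Finset.sum_const, smul_eq_mul]
        exact Nat.mul_le_mul_right _ h1
    _ = _ := by rw [pow_add]

variable {α : Type}

noncomputable def cyl {k : ℕ} (bit : α → Fin k → Bool) (S : Finset α)
    (π : Σ _ : Finset (Fin k), Finset (Fin k)) : Finset α :=
  S.filter fun u => ∀ b ∈ π.1, (bit u b = true ↔ b ∈ π.2)

theorem stable {k : ℕ} (bit : α → Fin k → Bool) (d L : ℕ) :
    ∀ (n : ℕ) (S : Finset α), ((Pats k d).filter fun π => (cyl bit S π).Nonempty).card ≤ n →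
      n * L < S.card → ∃ S' ⊆ S, S'.Nonempty ∧
        ∀ π ∈ Pats k d, (cyl bit S' π).Nonempty → L ≤ (cyl bit S' π).card := by
  intro n
  induction n with
  | zero =>
    intro S h1 h2
    refine ⟨S, subset_rfl, Finset.card_pos.1 (by omega), ?_⟩
    intro π hπ hne
    have : π ∈ ((Pats k d).filter fun π => (cyl bit S π).Nonempty) :=
      Finset.mem_filter.2 ⟨hπ, hne⟩
    have := Finset.card_pos.2 ⟨_, this⟩
    omega
  | succ n ih =>
    intro S h1 h2
    by_cases hall : ∀ π ∈ Pats k d, (cyl bit S π).Nonempty → L ≤ (cyl bit S π).card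
    · exact ⟨S, subset_rfl, Finset.card_pos.1 (by omega), hall⟩
    · push Not at hall
      obtain ⟨π, hπ, hne, hlt⟩ := hall
      have h3 : (S \ cyl bit S π).card = S.card - (cyl bit S π).card :=
        Finset.card_sdiff_of_subset (Finset.filter_subset _ _)
      have hA : ((Pats k d).filter fun ρ => (cyl bit (S \ cyl bit S π) ρ).Nonempty).card ≤ n := by
        have : ((Pats k d).filter fun ρ => (cyl bit (S \ cyl bit S π) ρ).Nonempty) ⊂
            ((Pats k d).filter fun π => (cyl bit S π).Nonempty) := by
          refine Finset.ssubset_iff_of_subset ?_ |>.2 ⟨π, Finset.mem_filter.2 ⟨hπ, hne⟩, ?_⟩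
          · intro ρ hρ
            rw [Finset.mem_filter] at *
            refine ⟨hρ.1, hρ.2.mono ?_⟩
            exact Finset.filter_subset_filter _ Finset.sdiff_subset
          · intro hcon
            obtain ⟨u, hu⟩ := (Finset.mem_filter.1 hcon).2
            simp only [cyl, Finset.mem_filter, Finset.mem_sdiff] at hu
            exact hu.1.2 ⟨hu.1.1, hu.2⟩
        have := Finset.card_lt_card this
        omega
      have hB : n * L < (S \ cyl bit S π).card := by
        rw [Nat.succ_mul] at h2
        omega
      obtain ⟨S', hS', h4⟩ := ih (S \ cyl bit S π) hA hB
      exact ⟨S', hS'.trans Finset.sdiff_subset, h4⟩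

def Sparse (H : SimpleGraph α) (s h : ℕ) (S : Finset α) : Prop :=
  ∃ A B : Finset α, A ⊆ S ∧ B ⊆ S ∧ s ≤ A.card ∧ s ≤ B.card ∧
    ∀ a ∈ A, (B.filter fun b => H.Adj a b).card * h < B.card

noncomputable def cn (H : SimpleGraph α) (Q T : Finset α) : Finset α := Q.filter fun w => ∀ u ∈ T, H.Adj u w

def GoodSet (H : SimpleGraph α) (Fam : Finset (Finset α)) (L h : ℕ) (U : Finset α) : Prop :=
  ∀ T ⊆ U, ∀ Q ∈ Fam, L ≤ (cn H Q T).card * h ^ T.card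

theorem good_ext [DecidableEq α] (H : SimpleGraph α) (Fam : Finset (Finset α)) (L h M s P : ℕ) (S : Finset α)
    (hh : 0 < h) (hP : Fam.card ≤ P) (hS : ∀ Q ∈ Fam, Q ⊆ S) (hsp : ¬ Sparse H s h S)
    (hL : h ^ M * (2 ^ M * P * s) < L) (U : Finset α) (hU : U.card < M)
    (hg : GoodSet H Fam L h U) (Q : Finset α) (hQ : Q ∈ Fam) :
    ∃ w ∈ Q, (∀ u ∈ U, H.Adj u w) ∧ GoodSet H Fam L h (insert w U) := by
  have hbig : ∀ T ⊆ U, ∀ Q ∈ Fam, 2 ^ M * P * s < (cn H Q T).card := by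
    intro T hT Q hQ
    have h1 := hg T hT Q hQ
    have h2 : h ^ T.card ≤ h ^ M :=
      Nat.pow_le_pow_right hh ((Finset.card_le_card hT).trans hU.le)
    have h3 := Nat.mul_le_mul_left (cn H Q T).card h2
    by_contra hcon
    have h4 := Nat.mul_le_mul_right (h ^ M) (not_lt.1 hcon)
    rw [mul_comm] at hL
    omega
  have hP1 : 1 ≤ 2 ^ M * P := by
    have : 1 ≤ Fam.card := Finset.card_pos.2 ⟨Q, hQ⟩
    exact Nat.mul_pos (by positivity) (by omega)
  have hs : ∀ T ⊆ U, ∀ Q ∈ Fam, s ≤ (cn H Q T).card := by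
    intro T hT Q hQ
    have := hbig T hT Q hQ
    have := Nat.mul_le_mul_right s hP1
    omega
  set A := cn H Q U with hA
  set bad : Finset α × Finset α → Finset α := fun TQ =>
    A.filter fun w => ((cn H TQ.2 TQ.1).filter fun b => H.Adj w b).card * h < (cn H TQ.2 TQ.1).card
    with hbad
  have hbs : ∀ TQ ∈ U.powerset ×ˢ Fam, (bad TQ).card ≤ s := by
    rintro ⟨T, Q'⟩ hTQ
    rw [Finset.mem_product, Finset.mem_powerset] at hTQ
    by_contra hcon
    refine hsp ⟨bad (T, Q'), cn H Q' T, ?_, ?_, by omega, hs T hTQ.1 Q' hTQ.2, ?_⟩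
    · exact ((Finset.filter_subset _ _).trans (Finset.filter_subset _ _)).trans (hS Q hQ)
    · exact (Finset.filter_subset _ _).trans (hS Q' hTQ.2)
    · intro a ha
      exact (Finset.mem_filter.1 ha).2
  have hun : ((U.powerset ×ˢ Fam).biUnion bad).card < A.card := by
    refine lt_of_le_of_lt (Finset.card_biUnion_le_card_mul _ _ s hbs) ?_
    refine lt_of_le_of_lt ?_ (hbig U subset_rfl Q hQ)
    refine Nat.mul_le_mul_right _ ?_
    rw [Finset.card_product, Finset.card_powerset]
    exact Nat.mul_le_mul (Nat.pow_le_pow_right (by norm_num) hU.le) hP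
  obtain ⟨w, hwA, hwb⟩ := Finset.exists_mem_notMem_of_card_lt_card hun
  have hwA' := Finset.mem_filter.1 hwA
  refine ⟨w, hwA'.1, hwA'.2, ?_⟩
  intro T hT Q' hQ'
  by_cases hwT : w ∈ T
  · have hT' : T.erase w ⊆ U := by
      intro z hz
      have := hT (Finset.mem_of_mem_erase hz)
      rcases Finset.mem_insert.1 this with h1 | h1
      · exact absurd h1 (Finset.ne_of_mem_erase hz)
      · exact h1
    have h1 := hg _ hT' Q' hQ'
    have h2 : (cn H Q' (T.erase w)).card ≤
        ((cn H Q' (T.erase w)).filter fun b => H.Adj w b).card * h := by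
      by_contra hcon
      refine hwb (Finset.mem_biUnion.2 ⟨(T.erase w, Q'), ?_, ?_⟩)
      · rw [Finset.mem_product, Finset.mem_powerset]
        exact ⟨hT', hQ'⟩
      · exact Finset.mem_filter.2 ⟨hwA, not_le.1 hcon⟩
    have h3 : (cn H Q' (T.erase w)).filter (fun b => H.Adj w b) ⊆ cn H Q' T := by
      intro z hz
      simp only [cn, Finset.mem_filter, Finset.mem_erase] at *
      refine ⟨hz.1.1, fun u hu => ?_⟩
      by_cases huw : u = w
      · rw [huw]; exact hz.2
      · exact hz.1.2 u ⟨huw, hu⟩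
    have h4 := Finset.card_le_card h3
    have h5 := Finset.card_erase_add_one hwT
    rw [← h5, pow_succ]
    calc L ≤ _ := h1
      _ ≤ ((cn H Q' T).card * h) * h ^ (T.erase w).card :=
          Nat.mul_le_mul_right _ (h2.trans (Nat.mul_le_mul_right _ h4))
      _ = _ := by ring
  · refine hg T ?_ Q' hQ'
    intro z hz
    rcases Finset.mem_insert.1 (hT hz) with h1 | h1
    · exact absurd (h1 ▸ hz) hwT
    · exact h1

/-- the combinatorial heart of the adversary strategy -/
structure Strat [DecidableEq α] {k : ℕ} (bit : α → Fin k → Bool) (H : SimpleGraph α) (d M : ℕ) where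
  S : Finset α
  ne : S.Nonempty
  Gd : Finset α → Prop
  empty : Gd ∅
  anti : ∀ U T, T ⊆ U → Gd U → Gd T
  ext : ∀ U, Gd U → U.card < M → ∀ v ∈ S, ∀ D : Finset (Fin k), D.card ≤ d →
    ∃ w ∈ S, (∀ b ∈ D, bit w b = bit v b) ∧ (∀ u ∈ U, H.Adj u w) ∧ Gd (insert w U)

theorem exists_strat [DecidableEq α] {k : ℕ} (bit : α → Fin k → Bool) (H : SimpleGraph α) (d M h s P : ℕ)
    (hh : 0 < h) (hP : (Pats k d).card ≤ P) (S : Finset α) (hsp : ¬ Sparse H s h S)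
    (hS : P * (h ^ M * (2 ^ M * P * s) + 1) < S.card) : Nonempty (Strat bit H d M) := by
  set L := h ^ M * (2 ^ M * P * s) + 1 with hL
  obtain ⟨S', hS', hne, hst⟩ := stable bit d L P S
    ((Finset.card_le_card (Finset.filter_subset _ _)).trans hP) hS
  set Fam : Finset (Finset α) := ((Pats k d).filter fun π => (cyl bit S' π).Nonempty).image
    (cyl bit S') with hFam
  have hFP : Fam.card ≤ P :=
    Finset.card_image_le.trans ((Finset.card_le_card (Finset.filter_subset _ _)).trans hP)
  have hFS : ∀ Q ∈ Fam, Q ⊆ S := by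
    intro Q hQ
    obtain ⟨π, _, rfl⟩ := Finset.mem_image.1 hQ
    exact (Finset.filter_subset _ _).trans hS'
  refine ⟨⟨S', hne, GoodSet H Fam L h, ?_, ?_, ?_⟩⟩
  · intro T hT Q hQ
    rw [Finset.subset_empty] at hT
    subst hT
    obtain ⟨π, hπ, rfl⟩ := Finset.mem_image.1 hQ
    rw [Finset.mem_filter] at hπ
    simpa [cn] using hst π hπ.1 hπ.2
  · intro U T hTU hU T' hT'
    exact hU T' (hT'.trans hTU)
  · intro U hU hUM v hv D hD
    set π : Σ _ : Finset (Fin k), Finset (Fin k) := ⟨D, D.filter fun b => bit v b = true⟩ with hπ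
    have hvπ : v ∈ cyl bit S' π := by
      simp only [cyl, Finset.mem_filter, hπ]
      tauto
    have hQ : cyl bit S' π ∈ Fam := by
      refine Finset.mem_image.2 ⟨π, Finset.mem_filter.2 ⟨?_, ⟨v, hvπ⟩⟩, rfl⟩
      simp only [Pats, hπ, Finset.mem_sigma, Finset.mem_filter, Finset.mem_powerset]
      exact ⟨⟨Finset.subset_univ _, hD⟩, Finset.filter_subset _ _⟩
    obtain ⟨w, hw, h1, h2⟩ := good_ext H Fam L h M s P S hh hFP hFS hsp (by omega) U hUM hU _ hQ
    simp only [cyl, Finset.mem_filter, hπ] at hw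
    refine ⟨w, hw.1, ?_, h1, h2⟩
    intro b hb
    have := hw.2 b hb
    rw [Bool.eq_iff_iff]
    tauto

end Comb

section RamseyPart

variable {α : Type}

def Hom (G : SimpleGraph α) (S : Finset α) (x y : ℕ) : Prop :=
  (∃ X ⊆ S, G.IsClique (X : Set α) ∧ x ≤ X.card) ∨
    (∃ X ⊆ S, Gᶜ.IsClique (X : Set α) ∧ y ≤ X.card)

theorem Hom.mono {G : SimpleGraph α} {S S' : Finset α} {x y : ℕ} (hs : S ⊆ S')
    (h : Hom G S x y) : Hom G S' x y := by
  rcases h with ⟨X, h1, h2⟩ | ⟨X, h1, h2⟩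
  · exact Or.inl ⟨X, h1.trans hs, h2⟩
  · exact Or.inr ⟨X, h1.trans hs, h2⟩

theorem clique_insert (G : SimpleGraph α) (X : Finset α) (v : α)
    (hX : G.IsClique (X : Set α)) (h : ∀ x ∈ X, G.Adj v x) :
    G.IsClique ((insert v X : Finset α) : Set α) ∧ (insert v X).card = X.card + 1 := by
  constructor
  · rw [Finset.coe_insert]
    exact hX.insert (fun b hb _ => h b hb)
  · refine Finset.card_insert_of_notMem ?_
    intro hv
    exact G.loopless.irrefl v (h v hv)

theorem ramsey_base (G : SimpleGraph α) : ∀ (n a b : ℕ) (S : Finset α), a + b = n →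
    2 ^ n ≤ S.card → Hom G S a b := by
  intro n
  induction n with
  | zero =>
    intro a b S hab hS
    exact Or.inl ⟨∅, by simp, by simp, by omega⟩
  | succ n ih =>
    intro a b S hab hS
    rcases Nat.eq_zero_or_pos a with ha | ha
    · exact Or.inl ⟨∅, by simp, by simp, by omega⟩
    rcases Nat.eq_zero_or_pos b with hb | hb
    · exact Or.inr ⟨∅, by simp, by simp, by omega⟩
    have hpos : 0 < 2 ^ (n + 1) := by positivity
    obtain ⟨v, hv⟩ := Finset.card_pos.1 (lt_of_lt_of_le hpos hS)
    set N1 := (S.erase v).filter fun u => G.Adj v u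
    set N2 := (S.erase v).filter fun u => ¬ G.Adj v u
    have h1 : N1.card + N2.card = (S.erase v).card :=
      Finset.card_filter_add_card_filter_not _
    have h2 := Finset.card_erase_add_one hv
    have hs1 : N1 ⊆ S := (Finset.filter_subset _ _).trans (Finset.erase_subset _ _)
    have hs2 : N2 ⊆ S := (Finset.filter_subset _ _).trans (Finset.erase_subset _ _)
    rw [pow_succ] at hS
    by_cases h3 : 2 ^ n ≤ N1.card
    · rcases ih (a - 1) b N1 (by omega) h3 with ⟨X, hX, hc, hx⟩ | ⟨X, hX, hc, hx⟩
      · have := clique_insert G X v hc (fun x hx => (Finset.mem_filter.1 (hX hx)).2)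
        exact Or.inl ⟨insert v X, Finset.insert_subset hv (hX.trans hs1), this.1, by omega⟩
      · exact Or.inr ⟨X, hX.trans hs1, hc, hx⟩
    · rcases ih a (b - 1) N2 (by omega) (by omega) with ⟨X, hX, hc, hx⟩ | ⟨X, hX, hc, hx⟩
      · exact Or.inl ⟨X, hX.trans hs2, hc, hx⟩
      · have := clique_insert Gᶜ X v hc (fun x hx => by
          have h4 := Finset.mem_filter.1 (hX hx)
          rw [SimpleGraph.compl_adj]
          exact ⟨(Finset.ne_of_mem_erase h4.1).symm, h4.2⟩)
        exact Or.inr ⟨insert v X, Finset.insert_subset hv (hX.trans hs2), this.1, by omega⟩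

theorem join_lemma (H : SimpleGraph α) (A B X : Finset α) (h r : ℕ)
    (hX : X ⊆ A) (hh : 0 < h)
    (hsp : ∀ a ∈ A, (B.filter fun b => H.Adj a b).card * h < B.card)
    (hcount : (X.powerset.filter fun D => D.card ≤ 2 * X.card / h).card ≤ 2 ^ r) :
    ∃ X' ⊆ X, ∃ B' ⊆ B, X.card ≤ X'.card + 2 * X.card / h ∧
      B.card ≤ 2 * 2 ^ r * (B'.card + X.card) ∧ ∀ x ∈ X', ∀ b ∈ B', Hᶜ.Adj x b := by
  set nb : α → Finset α := fun b => X.filter fun x => H.Adj x b with hnb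
  set B1 := B.filter fun b => (nb b).card ≤ 2 * X.card / h with hB1
  set B2 := B.filter fun b => ¬ (nb b).card ≤ 2 * X.card / h with hB2
  have h12 : B1.card + B2.card = B.card := Finset.card_filter_add_card_filter_not _
  have hsum : ∑ x ∈ X, (B.filter fun b => H.Adj x b).card = ∑ b ∈ B, (nb b).card :=
    Finset.sum_card_bipartiteAbove_eq_sum_card_bipartiteBelow (fun x b => H.Adj x b)
  have hle : (∑ b ∈ B, (nb b).card) * h ≤ X.card * B.card := by
    rw [← hsum, Finset.sum_mul, ← smul_eq_mul]
    exact Finset.sum_le_card_nsmul _ _ _ (fun x hx => (hsp x (hX hx)).le)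
  have hge : B2.card * (2 * X.card + 1) ≤ (∑ b ∈ B, (nb b).card) * h := by
    calc B2.card * (2 * X.card + 1) ≤ ∑ b ∈ B2, (nb b).card * h := by
          rw [← smul_eq_mul]
          refine Finset.card_nsmul_le_sum _ _ _ ?_
          intro b hb
          have h1 := not_le.1 (Finset.mem_filter.1 hb).2
          exact (Nat.div_lt_iff_lt_mul hh).1 h1
      _ ≤ ∑ b ∈ B, (nb b).card * h :=
          Finset.sum_le_sum_of_subset (Finset.filter_subset _ _)
      _ = _ := by rw [Finset.sum_mul]
  have hhalf : B.card ≤ 2 * B1.card := by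
    by_contra hcon
    nlinarith
  have hpig : ∃ J ∈ X.powerset.filter (fun D => D.card ≤ 2 * X.card / h),
      B1.card ≤ 2 ^ r * (B1.filter fun b => nb b = J).card := by
    have hmaps : ∀ b ∈ B1, nb b ∈ X.powerset.filter (fun D => D.card ≤ 2 * X.card / h) := by
      intro b hb
      rw [Finset.mem_filter, Finset.mem_powerset]
      exact ⟨Finset.filter_subset _ _, (Finset.mem_filter.1 hb).2⟩
    have hne : (X.powerset.filter (fun D => D.card ≤ 2 * X.card / h)).Nonempty :=
      ⟨∅, by simp⟩
    by_contra hcon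
    push Not at hcon
    have h1 := Finset.card_eq_sum_card_fiberwise hmaps
    have h2 : ∑ J ∈ X.powerset.filter (fun D => D.card ≤ 2 * X.card / h),
        2 ^ r * (B1.filter fun b => nb b = J).card <
        ∑ J ∈ X.powerset.filter (fun D => D.card ≤ 2 * X.card / h), B1.card :=
      Finset.sum_lt_sum_of_nonempty hne hcon
    rw [← Finset.mul_sum, ← h1, Finset.sum_const, smul_eq_mul] at h2
    have h3 := Nat.mul_le_mul_right B1.card hcount
    omega
  obtain ⟨J, hJ, hJ2⟩ := hpig
  rw [Finset.mem_filter, Finset.mem_powerset] at hJ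
  refine ⟨X \ J, Finset.sdiff_subset, (B1.filter fun b => nb b = J) \ X, ?_, ?_, ?_, ?_⟩
  · exact Finset.sdiff_subset.trans ((Finset.filter_subset _ _).trans (Finset.filter_subset _ _))
  · have := Finset.card_sdiff_add_card_eq_card hJ.1
    omega
  · have h1 : (B1.filter fun b => nb b = J).card ≤
        ((B1.filter fun b => nb b = J) \ X).card + X.card := by
      have := Finset.le_card_sdiff X (B1.filter fun b => nb b = J)
      omega
    calc B.card ≤ 2 * B1.card := hhalf
      _ ≤ 2 * (2 ^ r * (B1.filter fun b => nb b = J).card) := Nat.mul_le_mul_left _ hJ2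
      _ ≤ 2 * (2 ^ r * (((B1.filter fun b => nb b = J) \ X).card + X.card)) :=
          Nat.mul_le_mul_left _ (Nat.mul_le_mul_left _ h1)
      _ = _ := by ring
  · intro x hx b hb
    rw [Finset.mem_sdiff] at hx
    rw [Finset.mem_sdiff, Finset.mem_filter] at hb
    rw [SimpleGraph.compl_adj]
    refine ⟨?_, ?_⟩
    · rintro rfl
      exact hb.2 hx.1
    · intro hadj
      refine hx.2 ?_
      rw [← hb.1.2]
      exact Finset.mem_filter.2 ⟨hx.1, hadj⟩

theorem level_step (H : SimpleGraph α) (S : Finset α) (p e h m j : ℕ) (hp : 1 ≤ p) (he1 : 1 ≤ e)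
    (he : 8 * p ^ 2 ≤ 2 ^ e) (hh : 8 * p ^ 2 * e ≤ h) (hm : 4 ≤ m) (hj : 4 * p ≤ j)
    (hS : Sparse H (2 ^ ((j + 1) * m)) h S) :
    ∃ A ⊆ S, 2 ^ ((j + 1) * m) ≤ A.card ∧ ∀ X ⊆ A, X.card ≤ p * (p * m) →
      ∃ X' ⊆ X, ∃ B' ⊆ S, 2 ^ (j * m) ≤ B'.card ∧ X.card ≤ X'.card + p * m ∧
        ∀ x ∈ X', ∀ b ∈ B', Hᶜ.Adj x b := by
  obtain ⟨A, B, hA, hB, hAc, hBc, hsp⟩ := hS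
  refine ⟨A, hA, hAc, ?_⟩
  intro X hX hXc
  have hh0 : 0 < h := lt_of_lt_of_le (by positivity) hh
  have hd : 4 * (e * (2 * X.card / h)) ≤ m := by
    have h1 : 2 * X.card / h * h ≤ 2 * X.card := Nat.div_mul_le_self _ _
    set q := 2 * X.card / h
    have h2 : q * (8 * p ^ 2 * e) ≤ 2 * (p * (p * m)) :=
      (Nat.mul_le_mul_left q hh).trans (h1.trans (Nat.mul_le_mul_left 2 hXc))
    have h3 : (2 * p ^ 2) * (4 * (e * q)) ≤ (2 * p ^ 2) * m := by
      calc _ = q * (8 * p ^ 2 * e) := by ring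
        _ ≤ _ := h2
        _ = _ := by ring
    exact Nat.le_of_mul_le_mul_left h3 (by positivity)
  have hcount : (X.powerset.filter fun D => D.card ≤ 2 * X.card / h).card ≤ 2 ^ (m - 2) := by
    refine count_small X _ e _ ?_
    have h1 : 2 ≤ m := by omega
    obtain ⟨m', rfl⟩ := Nat.exists_eq_add_of_le h1
    have h2 : 4 * (2 * X.card) ≤ (2 + m') * 2 ^ e := by
      calc _ ≤ 4 * (2 * (p * (p * (2 + m')))) := by omega
        _ = (2 + m') * (8 * p ^ 2) := by ring
        _ ≤ _ := Nat.mul_le_mul_left _ he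
    have h3 := Nat.mul_le_mul_right (2 ^ e) hd
    have h4 : 2 + m' - 2 = m' := by omega
    rw [h4]
    have h5 : 2 ≤ m' := by omega
    have h6 := Nat.mul_le_mul_right (2 ^ e) h5
    nlinarith
  obtain ⟨X', hX', B', hB', h1, h2, h3⟩ := join_lemma H A B X h (m - 2) hX hh0 hsp hcount
  refine ⟨X', hX', B', hB'.trans hB, ?_, ?_, h3⟩
  · by_contra hcon
    have hXj : X.card ≤ 2 ^ (j * m) := by
      have h4 : p * m < 2 ^ (p * m) := Nat.lt_two_pow_self
      have h5 : p * (p * m) ≤ (p * m) * (p * m) := Nat.mul_le_mul_right _ (by nlinarith)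
      calc X.card ≤ (p * m) * (p * m) := hXc.trans h5
        _ ≤ 2 ^ (p * m) * 2 ^ (p * m) := Nat.mul_le_mul h4.le h4.le
        _ = 2 ^ (2 * (p * m)) := by ring
        _ ≤ 2 ^ (j * m) := Nat.pow_le_pow_right (by norm_num) (by nlinarith)
    have h6 : 2 * 2 ^ (m - 2) * (B'.card + X.card) < 2 * 2 ^ (m - 2) * (2 * 2 ^ (j * m)) :=
      Nat.mul_lt_mul_of_pos_left (by omega) (by positivity)
    have h7 : 2 * 2 ^ (m - 2) * (2 * 2 ^ (j * m)) = 2 ^ ((j + 1) * m) := by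
      have h1 : 2 ≤ m := by omega
      obtain ⟨m', rfl⟩ := Nat.exists_eq_add_of_le h1
      have h4 : 2 + m' - 2 = m' := by omega
      rw [h4]
      ring
    omega
  · have h4 : 2 * X.card / h ≤ e * (2 * X.card / h) := Nat.le_mul_of_pos_left _ he1
    have h5 : m ≤ p * m := Nat.le_mul_of_pos_left _ hp
    omega

theorem clique_union (G : SimpleGraph α) (X Y : Finset α) (hX : G.IsClique (X : Set α))
    (hY : G.IsClique (Y : Set α)) (h : ∀ x ∈ X, ∀ y ∈ Y, G.Adj x y) :
    G.IsClique ((X ∪ Y : Finset α) : Set α) ∧ (X ∪ Y).card = X.card + Y.card := by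
  constructor
  · intro u hu v hv huv
    rw [Finset.mem_coe, Finset.mem_union] at hu hv
    rcases hu with hu | hu <;> rcases hv with hv | hv
    · exact hX hu hv huv
    · exact h u hu v hv
    · exact (h v hv u hu).symm
    · exact hY hu hv huv
  · refine Finset.card_union_of_disjoint ?_
    rw [Finset.disjoint_left]
    intro a ha hb
    exact G.loopless.irrefl a (h a ha a hb)

theorem ramsey_a (G : SimpleGraph α) (p e h m : ℕ) (hp : 1 ≤ p) (he1 : 1 ≤ e)
    (he : 8 * p ^ 2 ≤ 2 ^ e) (hh : 8 * p ^ 2 * e ≤ h) (hm : 4 ≤ m)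
    (hsc : ∀ j (S : Finset α), 4 * p ≤ j → 2 ^ ((j + 1) * m) ≤ S.card →
      Sparse Gᶜ (2 ^ (j * m)) h S) :
    ∀ a (S : Finset α), a + 2 ≤ p → 2 ^ ((4 * p + 2 * a) * m) ≤ S.card →
      Hom G S ((a + 2) * (p * m)) (2 * (p * m)) := by
  intro a
  induction a with
  | zero =>
    intro S _ hS
    refine ramsey_base G _ _ _ S rfl ?_
    refine le_trans (le_of_eq ?_) hS
    congr 1
    ring
  | succ a ih =>
    intro S hap hS
    obtain ⟨A, hA, hAc, hst⟩ := level_step Gᶜ S p e h m (4 * p + 2 * a) hp he1 he hh hm (by omega)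
      (hsc _ S (by omega) hS)
    have hA2 : 2 ^ ((4 * p + 2 * a) * m) ≤ A.card :=
      le_trans (Nat.pow_le_pow_right (by norm_num) (Nat.mul_le_mul_right _ (by omega))) hAc
    rcases ih A (by omega) hA2 with ⟨X0, hX0, hc0, hx0⟩ | hX
    · obtain ⟨X, hXX, hXc⟩ := Finset.exists_subset_card_eq hx0
      have hc : G.IsClique (X : Set α) := hc0.subset (by exact_mod_cast hXX)
      obtain ⟨X', hX', B', hB', hB'c, hXX', hadj⟩ := hst X (hXX.trans hX0) (by
        rw [hXc]; exact Nat.mul_le_mul_right _ (by omega))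
      rw [compl_compl] at hadj
      have hB : Hom G B' (2 * (p * m)) (2 * (p * m)) := by
        refine ramsey_base G _ _ _ B' rfl ?_
        refine le_trans (Nat.pow_le_pow_right (by norm_num) ?_) hB'c
        nlinarith
      rcases hB with ⟨Y, hY, hYc, hy⟩ | hY
      · have := clique_union G X' Y (hc.subset (by exact_mod_cast hX')) hYc
          (fun x hx y hy => hadj x hx y (hY hy))
        refine Or.inl ⟨X' ∪ Y, Finset.union_subset (hX'.trans (hXX.trans (hX0.trans hA)))
          (hY.trans hB'), this.1, ?_⟩
        rw [this.2]
        have : (a + 1 + 2) * (p * m) = (a + 2) * (p * m) + p * m := by ring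
        omega
      · exact Hom.mono hB' (Or.inr hY)
    · exact Hom.mono hA (Or.inr hX)

theorem ramsey_ab (G : SimpleGraph α) (p e h m : ℕ) (hp : 1 ≤ p) (he1 : 1 ≤ e)
    (he : 8 * p ^ 2 ≤ 2 ^ e) (hh : 8 * p ^ 2 * e ≤ h) (hm : 4 ≤ m)
    (hs : ∀ j (S : Finset α), 4 * p ≤ j → 2 ^ ((j + 1) * m) ≤ S.card →
      Sparse G (2 ^ (j * m)) h S)
    (hsc : ∀ j (S : Finset α), 4 * p ≤ j → 2 ^ ((j + 1) * m) ≤ S.card →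
      Sparse Gᶜ (2 ^ (j * m)) h S) (a : ℕ) (ha : a + 2 ≤ p) :
    ∀ b (S : Finset α), b + 2 ≤ p → 2 ^ ((4 * p + 2 * a + 2 * b) * m) ≤ S.card →
      Hom G S ((a + 2) * (p * m)) ((b + 2) * (p * m)) := by
  intro b
  induction b with
  | zero =>
    intro S _ hS
    have := ramsey_a G p e h m hp he1 he hh hm hsc a S ha hS
    simpa using this
  | succ b ih =>
    intro S hap hS
    obtain ⟨A, hA, hAc, hst⟩ := level_step G S p e h m (4 * p + 2 * a + 2 * b) hp he1 he hh hm
      (by omega) (hs _ S (by omega) hS)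
    have hA2 : 2 ^ ((4 * p + 2 * a + 2 * b) * m) ≤ A.card :=
      le_trans (Nat.pow_le_pow_right (by norm_num) (Nat.mul_le_mul_right _ (by omega))) hAc
    rcases ih A (by omega) hA2 with hX | ⟨X0, hX0, hc0, hx0⟩
    · exact Hom.mono hA (Or.inl hX)
    · obtain ⟨X, hXX, hXc⟩ := Finset.exists_subset_card_eq hx0
      have hc : Gᶜ.IsClique (X : Set α) := hc0.subset (by exact_mod_cast hXX)
      obtain ⟨X', hX', B', hB', hB'c, hXX', hadj⟩ := hst X (hXX.trans hX0) (by
        rw [hXc]; exact Nat.mul_le_mul_right _ (by omega))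
      have hB : Hom G B' ((a + 2) * (p * m)) (2 * (p * m)) := by
        refine ramsey_a G p e h m hp he1 he hh hm hsc a B' ha ?_
        refine le_trans (Nat.pow_le_pow_right (by norm_num) ?_) hB'c
        exact Nat.mul_le_mul_right _ (by omega)
      rcases hB with hY | ⟨Y, hY, hYc, hy⟩
      · exact Hom.mono hB' (Or.inl hY)
      · have := clique_union Gᶜ X' Y (hc.subset (by exact_mod_cast hX')) hYc
          (fun x hx y hy => hadj x hx y (hY hy))
        refine Or.inr ⟨X' ∪ Y, Finset.union_subset (hX'.trans (hXX.trans (hX0.trans hA)))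
          (hY.trans hB'), this.1, ?_⟩
        rw [this.2]
        have : (b + 1 + 2) * (p * m) = (b + 2) * (p * m) + p * m := by ring
        omega

end RamseyPart

section PsiPart

theorem not_der {V : Type} [DecidableEq V] (φ : CNF V) (w : ℕ) (Good : Clause V → Prop)
    (h0 : Good ∅) (hax : ∀ C ∈ φ, ¬ Good C) (hweak : ∀ C C', C ⊆ C' → Good C' → Good C)
    (hq : ∀ C x, Good C → C.card + 1 ≤ w → Good (insert (x, true) C) ∨ Good (insert (x, false) C)) :
    ¬ Der φ ∅ w ∅ := by
  have key : ∀ C, Der φ ∅ w C → ¬ Good C := by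
    intro C hC
    induction hC with
    | ax C h => exact hax C h
    | weak C C' hs _ ih => exact fun h => ih (hweak C C' hs h)
    | res x C hw _ _ ih1 ih2 =>
      intro h
      rw [Finset.sdiff_empty] at hw
      rcases hq C x h hw with h1 | h1
      · exact ih1 h1
      · exact ih2 h1
  exact fun h => key _ h h0

theorem vbit_inj {k : ℕ} (u v : Fin (2 ^ k)) (h : ∀ b, vbit u b = vbit v b) : u = v := by
  apply Fin.ext
  apply Nat.eq_of_testBit_eq
  intro i
  by_cases hi : i < k
  · exact h ⟨i, hi⟩
  · have h1 : ∀ w : Fin (2 ^ k), Nat.testBit w.val i = false := fun w =>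
      Nat.testBit_lt_two_pow (lt_of_lt_of_le w.isLt (Nat.pow_le_pow_right (by norm_num) (by omega)))
    rw [h1, h1]

variable {c : ℝ} {k : ℕ}

theorem mem_lift_neq {i j : Fin (numIdx c k)} {u v : Fin (2 ^ k)} (b : Fin k) :
    ((Sum.inl (i, b), ! vbit u b) : PsiVar c k × Bool) ∈
      liftClause (neqClause c k i u ∪ neqClause c k j v) ∧
    ((Sum.inl (j, b), ! vbit v b) : PsiVar c k × Bool) ∈
      liftClause (neqClause c k i u ∪ neqClause c k j v) := by
  constructor
  · refine Finset.mem_image.2 ⟨((i, b), ! vbit u b), ?_, rfl⟩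
    refine Finset.mem_union_left _ (Finset.mem_image.2 ⟨b, Finset.mem_univ _, rfl⟩)
  · refine Finset.mem_image.2 ⟨((j, b), ! vbit v b), ?_, rfl⟩
    refine Finset.mem_union_right _ (Finset.mem_image.2 ⟨b, Finset.mem_univ _, rfl⟩)

theorem card_lift_le (i j : Fin (numIdx c k)) (u v : Fin (2 ^ k)) :
    (liftClause (neqClause c k i u ∪ neqClause c k j v)).card ≤ 2 * k := by
  refine Finset.card_image_le.trans ((Finset.card_union_le _ _).trans ?_)
  have h : ∀ i u, (neqClause c k i u).card ≤ k := by
    intro i u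
    refine Finset.card_image_le.trans ?_
    simp
  have := h i u
  have := h j v
  omega

theorem psi_clause_width (G : SimpleGraph (Fin (2 ^ k))) :
    ∀ C ∈ PsiCNF c G, C.card ≤ 2 * k + 1 := by
  rintro C (⟨i, j, _, v, rfl⟩ | ⟨i, j, _, u, v, _, rfl⟩ | ⟨i, j, _, u, v, _, _, rfl⟩)
  · have := card_lift_le (c := c) i j v v
    omega
  · have := card_lift_le (c := c) i j u v
    exact (Finset.card_insert_le _ _).trans (by omega)
  · have := card_lift_le (c := c) i j u v
    exact (Finset.card_insert_le _ _).trans (by omega)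

noncomputable def bitsOf (C : Clause (PsiVar c k)) (i : Fin (numIdx c k)) : Finset (Fin k) :=
  Finset.univ.filter fun b => ∃ s, ((Sum.inl (i, b), s) : PsiVar c k × Bool) ∈ C

noncomputable def heavy (d : ℕ) (C : Clause (PsiVar c k)) : Finset (Fin (numIdx c k)) :=
  Finset.univ.filter fun i => d ≤ (bitsOf C i).card

theorem bitsOf_mono {C C' : Clause (PsiVar c k)} (h : C ⊆ C') (i : Fin (numIdx c k)) :
    bitsOf C i ⊆ bitsOf C' i := by
  intro b hb
  simp only [bitsOf, Finset.mem_filter, Finset.mem_univ, true_and] at *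
  obtain ⟨s, hs⟩ := hb
  exact ⟨s, h hs⟩

theorem heavy_mono (d : ℕ) {C C' : Clause (PsiVar c k)} (h : C ⊆ C') : heavy d C ⊆ heavy d C' := by
  intro i hi
  simp only [heavy, Finset.mem_filter, Finset.mem_univ, true_and] at *
  exact hi.trans (Finset.card_le_card (bitsOf_mono h i))

theorem heavy_card (d : ℕ) (C : Clause (PsiVar c k)) : (heavy d C).card * d ≤ C.card := by
  calc (heavy d C).card * d ≤ ∑ i ∈ heavy d C, (bitsOf C i).card := by
        rw [← smul_eq_mul]
        refine Finset.card_nsmul_le_sum _ _ _ ?_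
        intro i hi
        exact (Finset.mem_filter.1 hi).2
    _ = ((heavy d C).sigma fun i => bitsOf C i).card := (Finset.card_sigma _ _).symm
    _ ≤ (C.image Prod.fst).card := by
        refine Finset.card_le_card_of_injOn (fun z => Sum.inl (z.1, z.2)) ?_ ?_
        · rintro ⟨i, b⟩ hz
          rw [Finset.mem_coe, Finset.mem_sigma] at hz
          simp only [bitsOf, Finset.mem_filter, Finset.mem_univ, true_and] at hz
          obtain ⟨s, hs⟩ := hz.2
          exact Finset.mem_image.2 ⟨_, hs, rfl⟩
        · rintro ⟨i, b⟩ _ ⟨i', b'⟩ _ h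
          simp only [Sum.inl.injEq, Prod.mk.injEq] at h
          obtain ⟨rfl, rfl⟩ := h
          rfl
    _ ≤ C.card := Finset.card_image_le

theorem bitsOf_insert_ne {C : Clause (PsiVar c k)} {i j : Fin (numIdx c k)} {b : Fin k} {s : Bool}
    (h : j ≠ i) : bitsOf (insert (Sum.inl (i, b), s) C) j = bitsOf C j := by
  ext b'
  simp [bitsOf, h]

theorem bitsOf_insert_y {C : Clause (PsiVar c k)} {j : Fin (numIdx c k)} {s : Bool} :
    bitsOf (insert (Sum.inr (), s) C) j = bitsOf C j := by
  ext b'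
  simp [bitsOf]

theorem psi_width (G H : SimpleGraph (Fin (2 ^ k))) (mode : Bool) (d M : ℕ)
    (hE : mode = false → ∀ u v, H.Adj u v → ¬ G.Adj u v)
    (hN : mode = true → ∀ u v, H.Adj u v → G.Adj u v)
    (hdk : d ≤ k) (hd : 0 < d) (st : Strat (fun v b => vbit (k := k) v b) H d M) :
    ¬ Der (PsiCNF c G) ∅ (d * M) ∅ := by
  refine not_der (PsiCNF c G) (d * M) (fun C =>
    (∀ s, ((Sum.inr (), s) : PsiVar c k × Bool) ∈ C → s = !mode) ∧
    ∃ vtx : Fin (numIdx c k) → Fin (2 ^ k), (∀ i, vtx i ∈ st.S) ∧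
      (∀ i b s, ((Sum.inl (i, b), s) : PsiVar c k × Bool) ∈ C → s = !vbit (vtx i) b) ∧
      (∀ i j, i ≠ j → i ∈ heavy d C → j ∈ heavy d C → H.Adj (vtx i) (vtx j)) ∧
      st.Gd ((heavy d C).image vtx)) ?_ ?_ ?_ ?_
  · obtain ⟨v, hv⟩ := st.ne
    have h0 : heavy d (∅ : Clause (PsiVar c k)) = ∅ := by
      have := heavy_card d (∅ : Clause (PsiVar c k))
      rw [Finset.card_empty] at this
      have h2 : (heavy d (∅ : Clause (PsiVar c k))).card = 0 := by
        rcases Nat.mul_eq_zero.1 (Nat.le_zero.1 this) with h | h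
        · exact h
        · omega
      exact Finset.card_eq_zero.1 h2
    refine ⟨by simp, fun _ => v, fun _ => hv, by simp, ?_, ?_⟩
    · rw [h0]; simp
    · rw [h0]; simpa using st.empty
  · have core : ∀ C : Clause (PsiVar c k), ∀ vtx : Fin (numIdx c k) → Fin (2 ^ k),
        (∀ i b s, ((Sum.inl (i, b), s) : PsiVar c k × Bool) ∈ C → s = !vbit (vtx i) b) →
        (∀ i j, i ≠ j → i ∈ heavy d C → j ∈ heavy d C → H.Adj (vtx i) (vtx j)) →
        ∀ i j u v, i ≠ j → liftClause (neqClause c k i u ∪ neqClause c k j v) ⊆ C →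
          H.Adj u v := by
      intro C vtx hcons hadj i j u v hij hsub
      have hu : vtx i = u := by
        refine vbit_inj _ _ fun b => ?_
        have := hcons i b _ (hsub (mem_lift_neq (i := i) (j := j) (u := u) (v := v) b).1)
        simpa using this.symm
      have hv : vtx j = v := by
        refine vbit_inj _ _ fun b => ?_
        have := hcons j b _ (hsub (mem_lift_neq (i := i) (j := j) (u := u) (v := v) b).2)
        simpa using this.symm
      have hi : i ∈ heavy d C := by
        have : bitsOf C i = Finset.univ := by
          ext b
          simp only [bitsOf, Finset.mem_filter, Finset.mem_univ, true_and, iff_true]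
          exact ⟨_, hsub (mem_lift_neq (i := i) (j := j) (u := u) (v := v) b).1⟩
        simp [heavy, this, hdk]
      have hj : j ∈ heavy d C := by
        have : bitsOf C j = Finset.univ := by
          ext b
          simp only [bitsOf, Finset.mem_filter, Finset.mem_univ, true_and, iff_true]
          exact ⟨_, hsub (mem_lift_neq (i := i) (j := j) (u := u) (v := v) b).2⟩
        simp [heavy, this, hdk]
      rw [← hu, ← hv]
      exact hadj i j hij hi hj
    rintro C (⟨i, j, hij, v, rfl⟩ | ⟨i, j, hij, u, v, huv, rfl⟩ | ⟨i, j, hij, u, v, hne, huv, rfl⟩)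
    · rintro ⟨_, vtx, _, hcons, hadj, _⟩
      exact H.loopless.irrefl v (core _ vtx hcons hadj i j v v hij subset_rfl)
    · rintro ⟨hy, vtx, _, hcons, hadj, _⟩
      have h1 := core _ vtx hcons hadj i j u v hij (Finset.subset_insert _ _)
      have h2 := hy true (Finset.mem_insert_self _ _)
      exact hE (by simpa using h2) u v h1 huv
    · rintro ⟨hy, vtx, _, hcons, hadj, _⟩
      have h1 := core _ vtx hcons hadj i j u v hij (Finset.subset_insert _ _)
      have h2 := hy false (Finset.mem_insert_self _ _)
      exact huv (hN (by simpa using h2) u v h1)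
  · rintro C C' hs ⟨hy, vtx, hS, hcons, hadj, hgd⟩
    refine ⟨fun s h => hy s (hs h), vtx, hS, fun i b s h => hcons i b s (hs h), ?_, ?_⟩
    · intro i j hij hi hj
      exact hadj i j hij (heavy_mono d hs hi) (heavy_mono d hs hj)
    · exact st.anti _ _ (Finset.image_subset_image (heavy_mono d hs)) hgd
  · rintro C x ⟨hy, vtx, hS, hcons, hadj, hgd⟩ hw
    rcases x with ⟨i, b⟩ | x
    · -- a helper: it suffices to produce one value
      suffices hsuf : ∃ s : Bool, (∀ s', ((Sum.inr (), s') : PsiVar c k × Bool) ∈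
            insert (Sum.inl (i, b), s) C → s' = !mode) ∧
          ∃ vtx : Fin (numIdx c k) → Fin (2 ^ k), (∀ i, vtx i ∈ st.S) ∧
            (∀ i' b' s', ((Sum.inl (i', b'), s') : PsiVar c k × Bool) ∈
              insert (Sum.inl (i, b), s) C → s' = !vbit (vtx i') b') ∧
            (∀ i' j', i' ≠ j' → i' ∈ heavy d (insert (Sum.inl (i, b), s) C) →
              j' ∈ heavy d (insert (Sum.inl (i, b), s) C) → H.Adj (vtx i') (vtx j')) ∧
            st.Gd ((heavy d (insert (Sum.inl (i, b), s) C)).image vtx) by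
        obtain ⟨s, h⟩ := hsuf
        cases s
        · exact Or.inr h
        · exact Or.inl h
      have hyy : ∀ s s', ((Sum.inr (), s') : PsiVar c k × Bool) ∈
            insert (Sum.inl (i, b), s) C → s' = !mode := by
        intro s s' h
        refine hy s' ?_
        simpa using h
      have hhv : ∀ s, ∀ j ∈ heavy d (insert (Sum.inl (i, b), s) C), j ≠ i → j ∈ heavy d C := by
        intro s j hj hne
        simp only [heavy, Finset.mem_filter, Finset.mem_univ, true_and] at *
        rwa [bitsOf_insert_ne hne] at hj
      have hsame : ∀ s, heavy d (insert (Sum.inl (i, b), s) C) ⊆ heavy d C ∨ 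
          heavy d (insert (Sum.inl (i, b), s) C) = insert i (heavy d C) := by
        intro s
        by_cases h1 : i ∈ heavy d (insert (Sum.inl (i, b), s) C)
        · right
          refine Finset.Subset.antisymm ?_ ?_
          · intro j hj
            by_cases hji : j = i
            · rw [hji]; exact Finset.mem_insert_self _ _
            · exact Finset.mem_insert_of_mem (hhv s j hj hji)
          · exact Finset.insert_subset h1 (heavy_mono d (Finset.subset_insert _ _))
        · left
          intro j hj
          refine hhv s j hj ?_
          rintro rfl
          exact h1 hj
      by_cases hkeep : heavy d (insert (Sum.inl (i, b), !vbit (vtx i) b) C) ⊆ heavy d C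
      · refine ⟨!vbit (vtx i) b, hyy _, vtx, hS, ?_, ?_, ?_⟩
        · intro i' b' s' h
          rcases Finset.mem_insert.1 h with h | h
          · simp only [Prod.mk.injEq, Sum.inl.injEq] at h
            obtain ⟨⟨rfl, rfl⟩, rfl⟩ := h
            rfl
          · exact hcons i' b' s' h
        · intro i' j' hij hi hj
          exact hadj i' j' hij (hkeep hi) (hkeep hj)
        · exact st.anti _ _ (Finset.image_subset_image hkeep) hgd
      · have hni : i ∉ heavy d C := by
          intro hi
          rcases hsame (!vbit (vtx i) b) with h | h
          · exact hkeep h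
          · refine hkeep ?_
            rw [h, Finset.insert_eq_of_mem hi]
        have hDc : (bitsOf C i).card ≤ d := by
          simp only [heavy, Finset.mem_filter, Finset.mem_univ, true_and] at hni
          omega
        have hUc : ((heavy d C).image vtx).card < M := by
          refine lt_of_le_of_lt Finset.card_image_le ?_
          have h1 := heavy_card d C
          by_contra hcon
          have h2 := Nat.mul_le_mul_right d (not_lt.1 hcon)
          rw [mul_comm M d] at h2
          omega
        obtain ⟨w, hwS, hwb, hwadj, hwg⟩ := st.ext _ hgd hUc (vtx i) (hS i) (bitsOf C i) hDc
        have hupd : ∀ j, j ≠ i → Function.update vtx i w j = vtx j := fun j hj =>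
          Function.update_of_ne hj _ _
        have hupi : Function.update vtx i w i = w := Function.update_self _ _ _
        have hall : ∀ s, heavy d (insert (Sum.inl (i, b), s) C) ⊆ insert i (heavy d C) := by
          intro s
          rcases hsame s with h | h
          · exact h.trans (Finset.subset_insert _ _)
          · exact h.le
        refine ⟨!vbit w b, hyy _, Function.update vtx i w, ?_, ?_, ?_, ?_⟩
        · intro j
          by_cases hj : j = i
          · rw [hj, hupi]; exact hwS
          · rw [hupd j hj]; exact hS j
        · intro i' b' s' h
          rcases Finset.mem_insert.1 h with h' | h'
          · simp only [Prod.mk.injEq, Sum.inl.injEq] at h'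
            obtain ⟨⟨rfl, rfl⟩, rfl⟩ := h'
            rw [hupi]
          · by_cases hj : i' = i
            · subst hj
              rw [hupi, hcons _ _ _ h']
              have : b' ∈ bitsOf C i' := by
                simp only [bitsOf, Finset.mem_filter, Finset.mem_univ, true_and]
                exact ⟨s', h'⟩
              rw [hwb b' this]
            · rw [hupd _ hj]
              exact hcons _ _ _ h'
        · intro i' j' hij hi hj
          by_cases h1 : i' = i
          · subst h1
            rw [hupi, hupd _ hij.symm]
            exact (hwadj _ (Finset.mem_image_of_mem _ (hhv _ j' hj hij.symm))).symm
          · by_cases h2 : j' = i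
            · subst h2
              rw [hupi, hupd _ hij]
              exact hwadj _ (Finset.mem_image_of_mem _ (hhv _ i' hi hij))
            · rw [hupd _ h1, hupd _ h2]
              exact hadj i' j' hij (hhv _ i' hi h1) (hhv _ j' hj h2)
        · refine st.anti _ _ ?_ hwg
          intro z hz
          obtain ⟨j, hj, rfl⟩ := Finset.mem_image.1 hz
          by_cases h1 : j = i
          · rw [h1, hupi]; exact Finset.mem_insert_self _ _
          · rw [hupd j h1]
            exact Finset.mem_insert_of_mem (Finset.mem_image_of_mem _ (hhv _ j hj h1))
    · have hh : ∀ s, heavy d (insert (Sum.inr x, s) C) = heavy d C := by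
        intro s
        ext j
        simp only [heavy, Finset.mem_filter, Finset.mem_univ, true_and]
        rw [bitsOf_insert_y]
      have hfin : (∀ s', ((Sum.inr (), s') : PsiVar c k × Bool) ∈
            insert (Sum.inr x, !mode) C → s' = !mode) ∧
          ∃ vtx : Fin (numIdx c k) → Fin (2 ^ k), (∀ i, vtx i ∈ st.S) ∧
            (∀ i' b' s', ((Sum.inl (i', b'), s') : PsiVar c k × Bool) ∈
              insert (Sum.inr x, !mode) C → s' = !vbit (vtx i') b') ∧
            (∀ i' j', i' ≠ j' → i' ∈ heavy d (insert (Sum.inr x, !mode) C) →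
              j' ∈ heavy d (insert (Sum.inr x, !mode) C) → H.Adj (vtx i') (vtx j')) ∧
            st.Gd ((heavy d (insert (Sum.inr x, !mode) C)).image vtx) := by
        refine ⟨?_, vtx, hS, ?_, ?_, ?_⟩
        · intro s' h
          rcases Finset.mem_insert.1 h with h | h
          · exact (Prod.mk.inj h).2
          · exact hy s' h
        · intro i' b' s' h
          refine hcons i' b' s' ?_
          simpa using h
        · rw [hh]; exact hadj
        · rw [hh]; exact hgd
      cases mode
      · exact Or.inl hfin
      · exact Or.inr hfin

theorem psi_sat (G H : SimpleGraph (Fin (2 ^ k))) (mode : Bool) (w : ℕ)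
    (hE : mode = false → ∀ u v, H.Adj u v → ¬ G.Adj u v)
    (hN : mode = true → ∀ u v, H.Adj u v → G.Adj u v)
    (X : Finset (Fin (2 ^ k))) (hX : H.IsClique (X : Set (Fin (2 ^ k))))
    (hXc : numIdx c k ≤ X.card) : ¬ Der (PsiCNF c G) ∅ w ∅ := by
  obtain ⟨f⟩ : Nonempty (Fin (numIdx c k) ↪ X) := by
    refine Function.Embedding.nonempty_of_card_le ?_
    simpa using hXc
  have hadj : ∀ i j, i ≠ j → H.Adj (f i).1 (f j).1 := by
    intro i j hij
    refine hX (f i).2 (f j).2 ?_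
    intro h
    exact hij (f.injective (Subtype.ext h))
  set a : PsiVar c k → Bool := fun x => match x with
    | Sum.inl (i, b) => vbit (f i).1 b
    | Sum.inr _ => mode with ha
  refine not_der (PsiCNF c G) w (fun C => ∀ l ∈ C, l.2 = !a l.1) (by simp) ?_ ?_ ?_
  · have core : ∀ C : Clause (PsiVar c k), (∀ l ∈ C, l.2 = !a l.1) →
        ∀ i j u v, i ≠ j → liftClause (neqClause c k i u ∪ neqClause c k j v) ⊆ C →
          H.Adj u v := by
      intro C hcons i j u v hij hsub
      have hu : (f i).1 = u := by
        refine vbit_inj _ _ fun b => ?_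
        have := hcons _ (hsub (mem_lift_neq (i := i) (j := j) (u := u) (v := v) b).1)
        simpa [ha] using this.symm
      have hv : (f j).1 = v := by
        refine vbit_inj _ _ fun b => ?_
        have := hcons _ (hsub (mem_lift_neq (i := i) (j := j) (u := u) (v := v) b).2)
        simpa [ha] using this.symm
      rw [← hu, ← hv]
      exact hadj i j hij
    rintro C (⟨i, j, hij, v, rfl⟩ | ⟨i, j, hij, u, v, huv, rfl⟩ | ⟨i, j, hij, u, v, hne, huv, rfl⟩)
    · intro h
      exact H.loopless.irrefl v (core _ h i j v v hij subset_rfl)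
    · intro h
      have h1 := core _ h i j u v hij (Finset.subset_insert _ _)
      have h2 := h _ (Finset.mem_insert_self _ _)
      exact hE (by simpa [ha] using h2) u v h1 huv
    · intro h
      have h1 := core _ h i j u v hij (Finset.subset_insert _ _)
      have h2 := h _ (Finset.mem_insert_self _ _)
      exact huv (hN (by simpa [ha] using h2) u v h1)
  · intro C C' hs h l hl
    exact h l (hs hl)
  · intro C x h _
    rcases hax : a x with _ | _
    · left
      intro l hl
      rcases Finset.mem_insert.1 hl with rfl | hl
      · simp [hax]
      · exact h l hl
    · right
      intro l hl
      rcases Finset.mem_insert.1 hl with rfl | hl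
      · simp [hax]
      · exact h l hl

end PsiPart

theorem psi_no_der (c : ℝ) (p k m d M e h g : ℕ) (G : SimpleGraph (Fin (2 ^ k))) (hp : 2 ≤ p)
    (hidx : numIdx c k ≤ p * (p * m)) (hk1 : 8 * p * m ≤ k) (hk2 : 2 * k ≤ (m / 8 + 1) * 2 ^ e)
    (he1 : 1 ≤ e) (he : 8 * p ^ 2 ≤ 2 ^ e) (hh : 8 * p ^ 2 * e ≤ h) (hg : 2 * h ≤ 2 ^ g)
    (hd : 16 * ((e + 1) * d) ≤ m) (hM : 8 * (g * M) ≤ m) (hm : 8 ≤ m) (hd0 : 0 < d) (hdk : d ≤ k) :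
    ¬ Der (PsiCNF c G) ∅ (d * M) ∅ := by
  intro hder
  have hh0 : 0 < h := lt_of_lt_of_le (by positivity) hh
  set r := e * d + (m / 8 + 1) with hr
  have hP : (Pats k d).card ≤ 2 ^ (r + d) := by
    refine card_Pats k d e r ?_
    rw [hr, add_mul]
    omega
  have hsize : ∀ j S, 2 ^ ((j + 1) * m) ≤ S →
      2 ^ (r + d) * (h ^ M * (2 ^ M * 2 ^ (r + d) * 2 ^ (j * m)) + 1) < S := by
    intro j S hS
    refine lt_of_lt_of_le ?_ hS
    have h1 : h ^ M * 2 ^ M ≤ 2 ^ (g * M) := by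
      rw [← mul_pow, pow_mul]
      exact Nat.pow_le_pow_left (by omega) M
    have h2 : 2 ^ (r + d) * (h ^ M * (2 ^ M * 2 ^ (r + d) * 2 ^ (j * m)) + 1) ≤
        2 ^ (2 * (r + d) + g * M + 1 + j * m) := by
      have h3 : 1 ≤ 2 ^ (g * M) * (2 ^ (r + d) * 2 ^ (j * m)) := Nat.one_le_iff_ne_zero.2 (by positivity)
      calc _ = 2 ^ (r + d) * ((h ^ M * 2 ^ M) * (2 ^ (r + d) * 2 ^ (j * m)) + 1) := by ring
        _ ≤ 2 ^ (r + d) * (2 ^ (g * M) * (2 ^ (r + d) * 2 ^ (j * m)) +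
              2 ^ (g * M) * (2 ^ (r + d) * 2 ^ (j * m))) := by
            refine Nat.mul_le_mul_left _ (Nat.add_le_add (Nat.mul_le_mul_right _ h1) h3)
        _ = _ := by ring
    refine lt_of_le_of_lt h2 (Nat.pow_lt_pow_right (by norm_num) ?_)
    have h4 : (j + 1) * m = m + j * m := by ring
    have h5 : (e + 1) * d = e * d + d := by ring
    omega
  have hs : ∀ j (S : Finset (Fin (2 ^ k))), 4 * p ≤ j → 2 ^ ((j + 1) * m) ≤ S.card →
      Sparse G (2 ^ (j * m)) h S := by
    intro j S _ hS
    by_contra hsp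
    obtain ⟨st⟩ := exists_strat (fun v b => vbit (k := k) v b) G d M h _ _ hh0 hP S hsp
      (hsize j _ hS)
    exact psi_width G G true d M (by simp) (fun _ _ _ h => h) hdk hd0 st hder
  have hsc : ∀ j (S : Finset (Fin (2 ^ k))), 4 * p ≤ j → 2 ^ ((j + 1) * m) ≤ S.card →
      Sparse Gᶜ (2 ^ (j * m)) h S := by
    intro j S _ hS
    by_contra hsp
    obtain ⟨st⟩ := exists_strat (fun v b => vbit (k := k) v b) Gᶜ d M h _ _ hh0 hP S hsp
      (hsize j _ hS)
    exact psi_width G Gᶜ false d M (fun _ u v h => ((SimpleGraph.compl_adj _ _ _).1 h).2)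
      (by simp) hdk hd0 st hder
  have hp2 : p - 2 + 2 = p := by omega
  have hH := ramsey_ab G p e h m (by omega) he1 he hh (by omega) hs hsc (p - 2) (by omega) (p - 2)
    Finset.univ (by omega) (by
      rw [Finset.card_univ, Fintype.card_fin]
      refine Nat.pow_le_pow_right (by norm_num) (le_trans (Nat.mul_le_mul_right _ ?_) hk1)
      omega)
  rw [hp2] at hH
  rcases hH with ⟨X, _, hX, hXc⟩ | ⟨X, _, hX, hXc⟩
  · exact psi_sat G G true _ (by simp) (fun _ _ _ h => h) X hX (hidx.trans hXc) hder
  · exact psi_sat G Gᶜ false _ (fun _ u v h => ((SimpleGraph.compl_adj _ _ _).1 h).2)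
      (by simp) X hX (hidx.trans hXc) hder

theorem exp_bound (N f t l : ℕ) (hN : 0 < N) (h : N ^ t ≤ l * (N - f) ^ t) :
    Real.exp ((f : ℝ) * t / N) ≤ l := by
  have hN' : (0 : ℝ) < N := by exact_mod_cast hN
  have h1 : ((N - f : ℕ) : ℝ) ≤ N * Real.exp (-(f : ℝ) / N) := by
    rcases le_total f N with hf | hf
    · rw [Nat.cast_sub hf]
      have h2 := Real.add_one_le_exp (-(f : ℝ) / N)
      calc (N : ℝ) - f = N * (-(f : ℝ) / N + 1) := by field_simp; ring
        _ ≤ _ := mul_le_mul_of_nonneg_left h2 hN'.le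
    · rw [Nat.sub_eq_zero_of_le hf]
      simp only [Nat.cast_zero]
      positivity
  have h3 : (N : ℝ) ^ t ≤ l * ((N - f : ℕ) : ℝ) ^ t := by exact_mod_cast h
  have h4 : ((N - f : ℕ) : ℝ) ^ t ≤ (N * Real.exp (-(f : ℝ) / N)) ^ t :=
    pow_le_pow_left₀ (by positivity) h1 t
  have h5 : (N : ℝ) ^ t ≤ l * ((N : ℝ) ^ t * Real.exp (-((f : ℝ) * t / N))) := by
    refine h3.trans ((mul_le_mul_of_nonneg_left h4 (by positivity)).trans (le_of_eq ?_))
    rw [mul_pow, ← Real.exp_nat_mul]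
    congr 3
    ring
  have h6 : (1 : ℝ) ≤ l * Real.exp (-((f : ℝ) * t / N)) := by
    have h7 : (N : ℝ) ^ t * 1 ≤ (N : ℝ) ^ t * (l * Real.exp (-((f : ℝ) * t / N))) := by
      rw [mul_one]
      refine h5.trans (le_of_eq (by ring))
    exact le_of_mul_le_mul_left h7 (by positivity)
  rw [Real.exp_neg, ← div_eq_mul_inv, one_le_div (Real.exp_pos _)] at h6
  exact h6

theorem half_floor (m q : ℕ) (hq : 0 < q) (h : q ≤ m) : m ≤ 2 * q * (m / q) := by
  have h1 := Nat.div_add_mod m q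
  have h2 := Nat.mod_lt m hq
  have h3 : 1 ≤ m / q := (Nat.one_le_div_iff hq).2 h
  nlinarith

set_option maxHeartbeats 4000000 in
/-- Fix `c > 0`. There is `ε > 0` such that for every sufficiently large
`k` and every graph `G` on `n = 2^k` vertices, every resolution refutation of `Ψ_G` has
length at least `n^(ε·log₂ n) = n^(ε·k)`. -/
theorem psi_resolution_lower_bound (c : ℝ) (hc : 0 < c) :
    ∃ ε : ℝ, 0 < ε ∧ ∃ K : ℕ, ∀ k : ℕ, K ≤ k →
      ∀ G : SimpleGraph (Fin (2 ^ k)), ∀ R : Refutation (PsiCNF c G),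
        ((2 ^ k : ℕ) : ℝ) ^ (ε * k) ≤ (R.length : ℝ) := by
  obtain ⟨p, hpc⟩ := exists_nat_ge (16 * c + 2)
  have hp : 2 ≤ p := by
    have : (2 : ℝ) ≤ p := by linarith
    exact_mod_cast this
  obtain ⟨e, hee⟩ : ∃ e, e = 2 * p + 8 := ⟨_, rfl⟩
  have he : 256 * p ^ 2 ≤ 2 ^ e := by
    have h1 : p < 2 ^ p := Nat.lt_two_pow_self
    have h2 : p ^ 2 ≤ (2 ^ p) ^ 2 := Nat.pow_le_pow_left h1.le 2
    calc 256 * p ^ 2 ≤ 256 * (2 ^ p) ^ 2 := Nat.mul_le_mul_left _ h2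
      _ = 2 ^ e := by rw [hee]; ring
  obtain ⟨h, hh⟩ : ∃ h, h = 8 * p ^ 2 * e := ⟨_, rfl⟩
  have he1 : 1 ≤ e := by omega
  have hh0 : 0 < h := by rw [hh]; positivity
  obtain ⟨g, hg⟩ : ∃ g, g = 2 * h := ⟨_, rfl⟩
  have hg2 : 2 * h ≤ 2 ^ g := by rw [hg]; exact Nat.lt_two_pow_self.le
  obtain ⟨κ, hκ⟩ : ∃ κ, κ = (2 * (16 * (e + 1))) * (2 * (8 * g)) := ⟨_, rfl⟩
  have hκ0 : 0 < κ := by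
    rw [hκ]
    have : 0 < g := by omega
    positivity
  obtain ⟨m0, hm0⟩ : ∃ m0, m0 = 8 + 16 * (e + 1) + 8 * g + κ * (64 * p + 4) := ⟨_, rfl⟩
  refine ⟨1 / (16 * (c + 2) * κ ^ 2 * (16 * p) ^ 4), by positivity, 8 * p * m0, ?_⟩
  intro k hk G R
  obtain ⟨m, hm⟩ : ∃ m, m = k / (8 * p) := ⟨_, rfl⟩
  have hp8 : 0 < 8 * p := by omega
  have hmm0 : m0 ≤ m := by
    rw [hm, Nat.le_div_iff_mul_le hp8, mul_comm]
    exact hk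
  have hk1 : 8 * p * m ≤ k := by
    rw [hm]; exact Nat.mul_div_le _ _
  have hm1 : 1 ≤ m := by omega
  have hk16 : k ≤ 16 * p * m := by
    have := half_floor k (8 * p) hp8 (by
      refine le_trans ?_ hk1
      exact Nat.le_mul_of_pos_right _ hm1)
    rw [← hm] at this
    calc k ≤ _ := this
      _ = _ := by ring
  obtain ⟨d, hd⟩ : ∃ d, d = m / (16 * (e + 1)) := ⟨_, rfl⟩
  obtain ⟨M, hM⟩ : ∃ M, M = m / (8 * g) := ⟨_, rfl⟩
  have hg0 : 0 < g := by omega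
  have hmd : m ≤ 2 * (16 * (e + 1)) * d := by
    rw [hd]; exact half_floor m _ (by omega) (by omega)
  have hmM : m ≤ 2 * (8 * g) * M := by
    rw [hM]; exact half_floor m _ (by omega) (by omega)
  have hd2 : 16 * ((e + 1) * d) ≤ m := by
    rw [← mul_assoc, hd]; exact Nat.mul_div_le _ _
  have hM2 : 8 * (g * M) ≤ m := by
    rw [← mul_assoc, hM]; exact Nat.mul_div_le _ _
  have hd0 : 0 < d := by
    rcases Nat.eq_zero_or_pos d with h0 | h0
    · rw [h0] at hmd; omega
    · exact h0
  have hdm : d ≤ m := by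
    rw [hd]; exact Nat.div_le_self _ _
  have hmk : m ≤ k := le_trans (Nat.le_mul_of_pos_left _ hp8) hk1
  have hW : m ^ 2 ≤ κ * (d * M) := by
    calc m ^ 2 = m * m := by ring
      _ ≤ (2 * (16 * (e + 1)) * d) * (2 * (8 * g) * M) := Nat.mul_le_mul hmd hmM
      _ = _ := by rw [hκ]; ring
  have hWk : 4 * k + 4 ≤ d * M := by
    have h1 : κ * (64 * p + 4) ≤ m := by omega
    have h2 : κ * (4 * k + 4) ≤ κ * (d * M) := by
      calc κ * (4 * k + 4) ≤ κ * ((64 * p + 4) * m) := by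
            refine Nat.mul_le_mul_left _ ?_
            nlinarith
        _ = (κ * (64 * p + 4)) * m := by ring
        _ ≤ m * m := Nat.mul_le_mul_right _ h1
        _ = m ^ 2 := by ring
        _ ≤ _ := hW
    exact Nat.le_of_mul_le_mul_left h2 hκ0
  have hkR : (k : ℝ) ≤ 16 * p * m := by exact_mod_cast hk16
  have hm1R : (1 : ℝ) ≤ m := by exact_mod_cast hm1
  have hnum : (numIdx c k : ℝ) ≤ c * k + 1 := (Nat.ceil_lt_add_one (by positivity)).le
  have hidx : numIdx c k ≤ p * (p * m) := by
    have h1 : (numIdx c k : ℝ) ≤ p * (p * m) := by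
      have hpR : (1 : ℝ) ≤ p := by exact_mod_cast (by omega : 1 ≤ p)
      have h2 : c * k ≤ c * (16 * p * m) := mul_le_mul_of_nonneg_left hkR hc.le
      have hpm : (1 : ℝ) ≤ p * m := one_le_mul_of_one_le_of_one_le hpR hm1R
      have h3 : (16 * c + 2) * (p * m : ℝ) ≤ p * (p * m) :=
        mul_le_mul_of_nonneg_right hpc (by positivity)
      nlinarith
    exact_mod_cast h1
  have hk2 : 2 * k ≤ (m / 8 + 1) * 2 ^ e := by
    have h1 : m ≤ 8 * (m / 8 + 1) := by omega
    calc 2 * k ≤ 32 * p * m := by nlinarith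
      _ ≤ 32 * p * (8 * (m / 8 + 1)) := Nat.mul_le_mul_left _ h1
      _ = (m / 8 + 1) * (256 * p) := by ring
      _ ≤ (m / 8 + 1) * (256 * p ^ 2) := Nat.mul_le_mul_left _ (by nlinarith)
      _ ≤ _ := Nat.mul_le_mul_left _ he
  have hnd := psi_no_der c p k m d M e h g G hp hidx hk1 hk2 he1 (by omega) hh.ge hg2 hd2 hM2
    (by omega) hd0 (by omega)
  obtain ⟨t, ht⟩ : ∃ t, t = d * M / 2 := ⟨_, rfl⟩
  obtain ⟨f, hf⟩ : ∃ f, f = d * M - t := ⟨_, rfl⟩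
  have hft : f + t = d * M := by omega
  rw [← hft] at hnd
  have hsw := size_width R f t (by omega)
    (fun C hC => (psi_clause_width G C hC).trans (by omega)) hnd
  have hcard : Fintype.card (PsiVar c k) = numIdx c k * k + 1 := by
    simp [Fintype.card_sum, Fintype.card_prod]
  rw [hcard] at hsw
  have hexp := exp_bound _ f t R.length (by omega) hsw
  refine le_trans ?_ hexp
  -- numeric comparison
  have hk1R : (1 : ℝ) ≤ k := by exact_mod_cast (by omega : 1 ≤ k)
  have hN : ((2 * (numIdx c k * k + 1) : ℕ) : ℝ) ≤ 2 * ((c + 2) * k ^ 2) := by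
    push_cast
    have h1 : (numIdx c k : ℝ) * k ≤ (c * k + 1) * k :=
      mul_le_mul_of_nonneg_right hnum (by positivity)
    nlinarith
  have hN0 : (0 : ℝ) < ((2 * (numIdx c k * k + 1) : ℕ) : ℝ) := by
    exact_mod_cast (by omega : 0 < 2 * (numIdx c k * k + 1))
  have hft2 : ((d * M : ℕ) : ℝ) ^ 2 ≤ 8 * (f * t) := by
    have h1 : d * M ≤ 2 * f := by omega
    have h2 : d * M ≤ 4 * t := by omega
    have h3 := Nat.mul_le_mul h1 h2
    have h4 : (d * M) ^ 2 ≤ 8 * (f * t) := by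
      calc (d * M) ^ 2 = d * M * (d * M) := by ring
        _ ≤ _ := h3
        _ = _ := by ring
    exact_mod_cast h4
  have hWR : (m : ℝ) ^ 2 ≤ κ * ((d * M : ℕ) : ℝ) := by exact_mod_cast hW
  have hk4 : (k : ℝ) ^ 4 ≤ (16 * p) ^ 4 * (κ ^ 2 * (8 * (f * t))) := by
    calc (k : ℝ) ^ 4 ≤ (16 * p * m) ^ 4 := pow_le_pow_left₀ (by positivity) hkR 4
      _ = (16 * p) ^ 4 * ((m : ℝ) ^ 2) ^ 2 := by ring
      _ ≤ (16 * p) ^ 4 * (κ * ((d * M : ℕ) : ℝ)) ^ 2 := by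
          refine mul_le_mul_of_nonneg_left ?_ (by positivity)
          exact pow_le_pow_left₀ (by positivity) hWR 2
      _ = (16 * p) ^ 4 * (κ ^ 2 * ((d * M : ℕ) : ℝ) ^ 2) := by ring
      _ ≤ _ := by
          refine mul_le_mul_of_nonneg_left ?_ (by positivity)
          exact mul_le_mul_of_nonneg_left hft2 (by positivity)
  set E : ℝ := 1 / (16 * (c + 2) * κ ^ 2 * (16 * p) ^ 4) with hE
  have hpR : (0 : ℝ) < p := by exact_mod_cast (by omega : 0 < p)
  have hκR : (0 : ℝ) < κ := by exact_mod_cast hκ0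
  have hE0 : 0 < E := by positivity
  have hmain : E * k ^ 2 ≤ (f : ℝ) * t / ((2 * (numIdx c k * k + 1) : ℕ) : ℝ) := by
    rw [le_div_iff₀ hN0]
    calc E * k ^ 2 * ((2 * (numIdx c k * k + 1) : ℕ) : ℝ) ≤ E * k ^ 2 * (2 * ((c + 2) * k ^ 2)) :=
          mul_le_mul_of_nonneg_left hN (by positivity)
      _ = E * (2 * (c + 2)) * k ^ 4 := by ring
      _ ≤ E * (2 * (c + 2)) * ((16 * p) ^ 4 * (κ ^ 2 * (8 * (f * t)))) :=
          mul_le_mul_of_nonneg_left hk4 (by positivity)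
      _ = f * t := by
          rw [hE]
          field_simp
          ring
  have h2k : ((2 ^ k : ℕ) : ℝ) ^ (E * k) = Real.exp (Real.log 2 * (E * k ^ 2)) := by
    rw [Real.rpow_def_of_pos (by positivity)]
    push_cast
    rw [Real.log_pow]
    congr 1
    ring
  rw [h2k]
  refine Real.exp_le_exp.2 (le_trans ?_ hmain)
  have := Real.log_two_lt_d9
  have hEk : 0 ≤ E * (k : ℝ) ^ 2 := by positivity
  nlinarith
end

section
/- There is a constant a > 0 such that for all sufficiently large k, a random graph G drawn from G(n, 1/2) with n = 2^k fails to have property P with probability at most 2^{−a·n^{1/3}}; in particular, G has property P with probability tending to 1 as n → ∞. -/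
open Classical
section PropPHelpers

theorem pp_testbit_inj (k : ℕ) : Function.Injective (fun (v : Fin (2 ^ k)) (b : Fin k) => vbit v b) := by
  intro v w h
  apply Fin.ext
  apply Nat.eq_of_testBit_eq
  intro i
  by_cases hi : i < k
  · exact congrFun h ⟨i, hi⟩
  · have hk : 2 ^ k ≤ 2 ^ i := Nat.pow_le_pow_right (by norm_num) (by omega)
    rw [Nat.testBit_lt_two_pow (lt_of_lt_of_le v.2 hk),
      Nat.testBit_lt_two_pow (lt_of_lt_of_le w.2 hk)]

theorem pp_testbit_bij (k : ℕ) : Function.Bijective (fun (v : Fin (2 ^ k)) (b : Fin k) => vbit v b) := by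
  classical
  rw [Fintype.bijective_iff_injective_and_card]
  exact ⟨pp_testbit_inj k, by simp⟩

noncomputable def ppCons {k : ℕ} (p : Fin k → Option Bool) : Finset (Fin (2 ^ k)) :=
  Finset.univ.filter fun v => ∀ (b : Fin k) (bit : Bool), p b = some bit → vbit v b = bit

theorem pp_cons_card {k : ℕ} (p : Fin k → Option Bool) :
    2 ^ k ≤ (ppCons p).card * 2 ^ (Finset.univ.filter fun b => (p b).isSome).card := by
  obtain ⟨g, hg1, hg2⟩ := Function.bijective_iff_has_inverse.mp (pp_testbit_bij k)
  have hg : ∀ f b, vbit (g f) b = f b := fun f b => congrFun (hg2 f) b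
  let F : Fin (2 ^ k) → (ppCons p) × ((Finset.univ.filter fun b => (p b).isSome) → Bool) :=
    fun v => (⟨g (fun b => (p b).getD (vbit v b)), by
      simp only [ppCons, Finset.mem_filter, Finset.mem_univ, true_and]
      intro b bit h
      rw [hg, h]; rfl⟩, fun b => vbit v b.1)
  have hF : Function.Injective F := by
    intro v w h
    apply pp_testbit_inj k
    funext b
    have h1 : g (fun b => (p b).getD (vbit v b)) = g (fun b => (p b).getD (vbit w b)) :=
      congrArg Subtype.val (congrArg Prod.fst h)
    have h2 := congrArg Prod.snd h
    by_cases hb : (p b).isSome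
    · exact congrFun h2 ⟨b, by simp [hb]⟩
    · have h3 := congrArg (fun z => vbit z b) h1
      simp only [hg] at h3
      have : p b = none := by simpa using hb
      simpa [this] using h3
  have := Fintype.card_le_of_injective F hF
  rw [Fintype.card_prod, Fintype.card_fun, Fintype.card_coe, Fintype.card_coe, Fintype.card_fin,
    Fintype.card_bool] at this
  exact this

def ppRepl {V : Type} (U T : Finset V) (G : SimpleGraph V) (f : T → U → Bool) : SimpleGraph V :=
  SimpleGraph.fromRel fun x y =>
    (∃ (hx : x ∈ U) (hy : y ∈ T), f ⟨y, hy⟩ ⟨x, hx⟩ = true) ∨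
    (¬ (x ∈ U ∧ y ∈ T) ∧ ¬ (y ∈ U ∧ x ∈ T) ∧ G.Adj x y)

theorem pp_repl_in {V : Type} {U T : Finset V} (h : Disjoint U T) (G : SimpleGraph V)
    (f : T → U → Bool) (x : U) (y : T) : (ppRepl U T G f).Adj x.1 y.1 ↔ f y x = true := by
  have hd := Finset.disjoint_left.mp h
  obtain ⟨x, hx⟩ := x
  obtain ⟨y, hy⟩ := y
  have h1 : x ≠ y := by rintro rfl; exact hd hx hy
  have h2 : y ∉ U := fun h => hd h hy
  simp [ppRepl, SimpleGraph.fromRel_adj, h1, h2, hx, hy]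

theorem pp_repl_out {V : Type} {U T : Finset V} (G : SimpleGraph V)
    (f : T → U → Bool) (x y : V) (h1 : ¬ (x ∈ U ∧ y ∈ T)) (h2 : ¬ (y ∈ U ∧ x ∈ T)) :
    (ppRepl U T G f).Adj x y ↔ G.Adj x y := by
  simp only [ppRepl, SimpleGraph.fromRel_adj]
  constructor
  · rintro ⟨_, (⟨a, b, _⟩ | h) | (⟨a, b, _⟩ | h)⟩
    · exact absurd ⟨a, b⟩ h1
    · exact h.2.2
    · exact absurd ⟨a, b⟩ h2
    · exact h.2.2.symm
  · intro h
    exact ⟨h.ne, Or.inl (Or.inr ⟨h1, h2, h⟩)⟩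

noncomputable def ppBad {V : Type} [Fintype (SimpleGraph V)] (U T : Finset V) : Finset (SimpleGraph V) :=
  Finset.univ.filter fun G => ∀ v ∈ T, ∃ u ∈ U, ¬ G.Adj u v

theorem pp_bad_card {V : Type} [Fintype (SimpleGraph V)] (U T : Finset V) (h : Disjoint U T) :
    (ppBad U T).card * (2 ^ U.card) ^ T.card ≤
      (2 ^ U.card - 1) ^ T.card * Fintype.card (SimpleGraph V) := by
  let F : (ppBad U T) × (T → U → Bool) →
      (T → {f : U → Bool // f ≠ fun _ => true}) × SimpleGraph V :=
    fun z => (fun t => ⟨fun u => decide (z.1.1.Adj u.1 t.1), by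
      have hz := z.1.2
      simp only [ppBad, Finset.mem_filter, Finset.mem_univ, true_and] at hz
      obtain ⟨u, hu, hn⟩ := hz t.1 t.2
      intro hc
      have := congrFun hc ⟨u, hu⟩
      simp at this
      exact hn this⟩, ppRepl U T z.1.1 z.2)
  have hF : Function.Injective F := by
    rintro ⟨⟨G, hG⟩, f⟩ ⟨⟨G', hG'⟩, f'⟩ he
    have h1 := congrArg Prod.fst he
    have h2 : ppRepl U T G f = ppRepl U T G' f' := congrArg Prod.snd he
    have h3 : ∀ u ∈ U, ∀ t ∈ T, (G.Adj u t ↔ G'.Adj u t) := by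
      intro u hu t ht
      have h4 := congrArg Subtype.val (congrFun h1 ⟨t, ht⟩)
      have h5 := congrFun h4 ⟨u, hu⟩
      simpa [F] using h5
    have hf : f = f' := by
      funext t u
      have a1 := pp_repl_in h G f u t
      have a2 := pp_repl_in h G' f' u t
      rw [h2] at a1
      exact Bool.eq_iff_iff.mpr (a1.symm.trans a2)
    have hGG : G = G' := by
      ext x y
      by_cases c1 : x ∈ U ∧ y ∈ T
      · exact h3 x c1.1 y c1.2
      by_cases c2 : y ∈ U ∧ x ∈ T
      · rw [G.adj_comm, G'.adj_comm]
        exact h3 y c2.1 x c2.2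
      rw [← pp_repl_out G f x y c1 c2, h2, pp_repl_out G' f' x y c1 c2]
    subst hf hGG
    rfl
  have := Fintype.card_le_of_injective F hF
  have hc : Fintype.card {f : U → Bool // f ≠ fun _ => true} = 2 ^ U.card - 1 := by
    rw [Fintype.card_subtype_compl]
    simp
  rw [Fintype.card_prod, Fintype.card_prod, Fintype.card_fun, Fintype.card_fun, Fintype.card_fun, hc] at this
  simpa using this

theorem pp_bad_real {V : Type} [Fintype (SimpleGraph V)] (U T : Finset V) (h : Disjoint U T) :
    ((ppBad U T).card : ℝ) ≤
      Real.exp (-((T.card : ℝ) / 2 ^ U.card)) * Fintype.card (SimpleGraph V) := by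
  have h1 : ((ppBad U T).card : ℝ) * (2 ^ U.card) ^ T.card ≤
      (2 ^ U.card - 1) ^ T.card * Fintype.card (SimpleGraph V) := by
    have := pp_bad_card U T h
    have h2 : ((2 ^ U.card - 1 : ℕ) : ℝ) = 2 ^ U.card - 1 := by
      rw [Nat.cast_sub Nat.one_le_two_pow]; simp
    rw [← h2]
    exact_mod_cast this
  set M : ℝ := 2 ^ U.card with hM
  have hM1 : 1 ≤ M := one_le_pow₀ (by norm_num)
  have hM0 : 0 < M := by linarith
  have h3 : (M - 1) ^ T.card ≤ Real.exp (-((T.card : ℝ) / M)) * M ^ T.card := by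
    have h4 : M - 1 ≤ Real.exp (-(1 / M)) * M := by
      have := Real.add_one_le_exp (-(1 / M))
      calc M - 1 = (-(1 / M) + 1) * M := by field_simp; ring
        _ ≤ _ := by gcongr
    calc (M - 1) ^ T.card ≤ (Real.exp (-(1 / M)) * M) ^ T.card :=
          pow_le_pow_left₀ (by linarith) h4 _
      _ = _ := by
          rw [mul_pow, ← Real.exp_nat_mul]
          congr 2
          ring
  have h5 : 0 < M ^ T.card := by positivity
  refine le_of_mul_le_mul_right ?_ h5
  calc _ ≤ _ := h1
    _ ≤ (Real.exp (-((T.card : ℝ) / M)) * M ^ T.card) * Fintype.card (SimpleGraph V) := by gcongr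
    _ = _ := by ring

theorem pp_card_bound {k s m S t : ℕ} (hs : 3 * s ≤ k) (hm : 3 * m ≤ k) (hS : 2 ^ k ≤ S * 2 ^ s)
    (ht : S ≤ t + m) (x : ℝ) (hx0 : 0 ≤ x) (hx : x ^ 3 = 2 ^ k) :
    x - 1 ≤ (t : ℝ) / 2 ^ m := by
  obtain ⟨r, hr⟩ : ∃ r, k = r + s + m := ⟨k - s - m, by omega⟩
  have h1 : x ≤ 2 ^ r := by
    refine le_of_pow_le_pow_left₀ (n := 3) (by norm_num) (by positivity) ?_
    rw [hx, ← pow_mul]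
    exact pow_le_pow_right₀ (by norm_num) (by omega)
  have h2 : (2 : ℝ) ^ r * 2 ^ m ≤ S := by
    have h3 : 2 ^ r * 2 ^ m ≤ S := by
      have : 0 < 2 ^ s := by positivity
      refine Nat.le_of_mul_le_mul_right ?_ this
      calc 2 ^ r * 2 ^ m * 2 ^ s = 2 ^ k := by rw [hr]; ring
        _ ≤ _ := hS
    exact_mod_cast h3
  have h4 : (S : ℝ) ≤ t + m := by exact_mod_cast ht
  have h5 : (m : ℝ) ≤ 2 ^ m := by exact_mod_cast (Nat.lt_two_pow_self (n := m)).le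
  have h6 : (0 : ℝ) < 2 ^ m := by positivity
  rw [le_div_iff₀ h6]
  nlinarith

theorem pp_subsets_card (n k : ℕ) (hn : 1 ≤ n) :
    (Finset.univ.filter fun U : Finset (Fin n) => 3 * U.card ≤ k).card ≤ (k + 1) * n ^ k := by
  have h1 : (Finset.univ.filter fun U : Finset (Fin n) => 3 * U.card ≤ k) ⊆
      (Finset.range (k + 1)).biUnion fun i => Finset.powersetCard i Finset.univ := by
    intro U hU
    simp at hU ⊢
    omega
  refine (Finset.card_le_card h1).trans ?_
  refine (Finset.card_biUnion_le_card_mul _ _ (n ^ k) ?_).trans (by simp)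
  intro i hi
  simp only [Finset.card_powersetCard, Finset.card_univ, Fintype.card_fin]
  refine (Nat.choose_le_pow n i).trans ?_
  exact Nat.pow_le_pow_right hn (by simp at hi; omega)

theorem pp_union (k : ℕ) (x : ℝ) (hx0 : 0 ≤ x) (hx : x ^ 3 = 2 ^ k) :
    probOf (fun G : SimpleGraph (Fin (2 ^ k)) => ¬ PropertyP G) ≤
      2 ^ (k ^ 2 + 3 * k) * Real.exp (1 - x) := by
  let I : Finset (Finset (Fin (2 ^ k)) × (Fin k → Option Bool)) :=
    ((Finset.univ.filter fun U : Finset (Fin (2 ^ k)) => 3 * U.card ≤ k) ×ˢ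
      (Finset.univ.filter fun p : Fin k → Option Bool =>
        3 * (Finset.univ.filter fun b => (p b).isSome).card ≤ k))
  have hI : I.card ≤ 2 ^ (k ^ 2 + 3 * k) := by
    calc I.card = _ := Finset.card_product _ _
      _ ≤ ((k + 1) * (2 ^ k) ^ k) * 3 ^ k := by
          gcongr
          · exact pp_subsets_card _ _ Nat.one_le_two_pow
          · refine (Finset.card_le_univ _).trans ?_
            simp
      _ ≤ (2 ^ k * (2 ^ k) ^ k) * 4 ^ k := by
          gcongr
          · exact Nat.lt_two_pow_self
          · norm_num
      _ = _ := by
          rw [show 4 = 2 ^ 2 by norm_num, ← pow_mul, ← pow_mul, ← pow_add, ← pow_add]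
          congr 1
          ring
  have hsub : (Finset.univ.filter fun G : SimpleGraph (Fin (2 ^ k)) => ¬ PropertyP G) ⊆
      I.biUnion fun z => ppBad z.1 (ppCons z.2 \ z.1) := by
    intro G hG
    have hG := (Finset.mem_filter.mp hG).2
    unfold PropertyP at hG
    push Not at hG
    obtain ⟨U, hU, p, hp, hv⟩ := hG
    simp only [Finset.mem_biUnion]
    refine ⟨(U, p), by simp [I, hU]; convert hp, ?_⟩
    simp only [ppBad, Finset.mem_filter, Finset.mem_univ, true_and, Finset.mem_sdiff]
    rintro v ⟨hv1, _⟩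
    by_contra hc
    push Not at hc
    obtain ⟨b, bit, h1, h2⟩ := hv v hc
    simp only [ppCons, Finset.mem_filter, Finset.mem_univ, true_and] at hv1
    exact h2 (hv1 b bit h1)
  have hN : (0 : ℝ) < Fintype.card (SimpleGraph (Fin (2 ^ k))) := by
    exact_mod_cast Fintype.card_pos
  unfold probOf
  rw [div_le_iff₀ hN]
  calc _ ≤ (((I.biUnion fun z => ppBad z.1 (ppCons z.2 \ z.1)).card : ℕ) : ℝ) := by
        refine Nat.cast_le.mpr (le_trans (le_of_eq ?_) (Finset.card_le_card hsub))
        congr!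
    _ ≤ ∑ z ∈ I, ((ppBad z.1 (ppCons z.2 \ z.1)).card : ℝ) := by
        exact_mod_cast Finset.card_biUnion_le
    _ ≤ ∑ z ∈ I, Real.exp (1 - x) * Fintype.card (SimpleGraph (Fin (2 ^ k))) := by
        refine Finset.sum_le_sum fun z hz => ?_
        refine (pp_bad_real _ _ Finset.disjoint_sdiff).trans ?_
        gcongr
        simp only [I, Finset.mem_product, Finset.mem_filter, Finset.mem_univ, true_and] at hz
        have := pp_card_bound (t := (ppCons z.2 \ z.1).card) hz.2 hz.1 (pp_cons_card z.2)
          (by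
            have := Finset.le_card_sdiff z.1 (ppCons z.2)
            omega) x hx0 hx
        linarith
    _ = I.card * (Real.exp (1 - x) * Fintype.card (SimpleGraph (Fin (2 ^ k)))) := by simp
    _ ≤ 2 ^ (k ^ 2 + 3 * k) * (Real.exp (1 - x) * Fintype.card (SimpleGraph (Fin (2 ^ k)))) := by
        gcongr
        exact_mod_cast hI
    _ = _ := by ring

theorem pp_event : ∃ K : ℕ, ∀ k : ℕ, K ≤ k → ∀ x : ℝ, x = ((2 ^ k : ℕ) : ℝ) ^ ((1 : ℝ) / 3) →
    (k : ℝ) ^ 2 + 3 * k + 1 ≤ x * (3 / 10) := by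
  have hr : (1 : ℝ) < (2 : ℝ) ^ ((1 : ℝ) / 3) := Real.one_lt_rpow (by norm_num) (by norm_num)
  have h := isLittleO_pow_const_const_pow_of_one_lt (R := ℝ) 2 hr
  have h2 := (h.def (c := 3 / 50) (by norm_num))
  obtain ⟨K, hK⟩ := Filter.eventually_atTop.mp h2
  refine ⟨max K 1, fun k hk x hx => ?_⟩
  have h3 := hK k (le_trans (le_max_left _ _) hk)
  have h4 : (1 : ℝ) ≤ k := by exact_mod_cast (le_trans (le_max_right _ _) hk)
  have h5 : x = ((2 : ℝ) ^ ((1 : ℝ) / 3)) ^ k := by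
    rw [hx, ← Real.rpow_natCast, ← Real.rpow_mul (by norm_num)]
    push_cast
    rw [← Real.rpow_natCast, ← Real.rpow_mul (by norm_num), mul_comm]
  rw [← h5] at h3
  have h6 : 0 ≤ x := by rw [hx]; positivity
  rw [Real.norm_of_nonneg (by positivity), Real.norm_of_nonneg h6] at h3
  nlinarith

theorem pp_main : ∃ K : ℕ, ∀ k : ℕ, K ≤ k →
        probOf (fun G : SimpleGraph (Fin (2 ^ k)) => ¬ PropertyP G) ≤
          (2 : ℝ) ^ (-(1 * (((2 ^ k : ℕ) : ℝ) ^ ((1 : ℝ) / 3)))) := by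
  obtain ⟨K, hK⟩ := pp_event
  refine ⟨K, fun k hk => ?_⟩
  have h1 := hK k hk _ rfl
  set x := ((2 ^ k : ℕ) : ℝ) ^ ((1 : ℝ) / 3) with hx
  have hx0 : 0 ≤ x := by positivity
  have hx3 : x ^ 3 = 2 ^ k := by
    rw [hx, ← Real.rpow_natCast, ← Real.rpow_mul (by positivity)]
    norm_num
  refine (pp_union k x hx0 hx3).trans ?_
  have hl := Real.log_two_lt_d9
  have hl0 : 0 < Real.log 2 := Real.log_pos (by norm_num)
  rw [← Real.rpow_natCast, Real.rpow_def_of_pos (by norm_num), Real.rpow_def_of_pos (by norm_num),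
    ← Real.exp_add]
  apply Real.exp_le_exp.mpr
  push_cast
  have hk0 : (0 : ℝ) ≤ (k : ℝ) ^ 2 + 3 * k := by positivity
  nlinarith [mul_nonneg hk0 (by linarith : (0 : ℝ) ≤ 1 - Real.log 2),
    mul_nonneg hx0 (by linarith : (0 : ℝ) ≤ 7 / 10 - Real.log 2)]

theorem pp_compl {α : Type} [Fintype α] [Nonempty α] (P : α → Prop) :
    probOf P = 1 - probOf (fun a => ¬ P a) := by
  unfold probOf
  have hN : (0 : ℝ) < Fintype.card α := by exact_mod_cast Fintype.card_pos
  have := Finset.card_filter_add_card_filter_not (s := (Finset.univ : Finset α)) P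
  rw [eq_sub_iff_add_eq, ← add_div, div_eq_one_iff_eq hN.ne']
  rw [Finset.card_univ] at this
  rw [← this]
  push_cast
  congr!

theorem pp_tendsto : Filter.Tendsto (fun k : ℕ => (2 : ℝ) ^ (-(1 * (((2 ^ k : ℕ) : ℝ) ^ ((1 : ℝ) / 3)))))
    Filter.atTop (nhds 0) := by
  have h1 : Filter.Tendsto (fun k : ℕ => ((2 ^ k : ℕ) : ℝ) ^ ((1 : ℝ) / 3)) Filter.atTop Filter.atTop := by
    refine (tendsto_rpow_atTop (by norm_num)).comp ?_
    exact tendsto_natCast_atTop_atTop.comp (tendsto_pow_atTop_atTop_of_one_lt (by norm_num))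
  have h2 := (tendsto_rpow_atBot_of_base_gt_one 2 (by norm_num)).comp
    (Filter.tendsto_neg_atTop_atBot.comp h1)
  simpa [Function.comp_def] using h2

end PropPHelpers

/-- There is `a > 0` such that for all sufficiently large `k`, a random
graph from `G(n, 1/2)` with `n = 2^k` (i.e. uniform on `SimpleGraph (Fin (2^k))`) fails
property P with probability at most `2^(−a·n^(1/3))`; in particular the probability of
property P tends to `1` as `n → ∞`. -/
theorem random_graph_has_propertyP :
    ∃ a : ℝ, 0 < a ∧
      (∃ K : ℕ, ∀ k : ℕ, K ≤ k →
        probOf (fun G : SimpleGraph (Fin (2 ^ k)) => ¬ PropertyP G) ≤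
          (2 : ℝ) ^ (-(a * (((2 ^ k : ℕ) : ℝ) ^ ((1 : ℝ) / 3))))) ∧
      Filter.Tendsto (fun k : ℕ => probOf (fun G : SimpleGraph (Fin (2 ^ k)) => PropertyP G))
        Filter.atTop (nhds 1) := by
  obtain ⟨K, hK⟩ := pp_main
  refine ⟨1, one_pos, ⟨K, hK⟩, ?_⟩
  have h0 : Filter.Tendsto (fun k : ℕ => probOf (fun G : SimpleGraph (Fin (2 ^ k)) => ¬ PropertyP G))
      Filter.atTop (nhds 0) := by
    refine tendsto_of_tendsto_of_tendsto_of_le_of_le' tendsto_const_nhds pp_tendsto ?_ ?_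
    · exact Filter.Eventually.of_forall fun k => by unfold probOf; positivity
    · exact Filter.eventually_atTop.mpr ⟨K, hK⟩
  have h1 := h0.const_sub 1
  rw [sub_zero] at h1
  exact h1.congr fun k => (pp_compl _).symm
end
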